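/- arXiv:2308.12268 — 4 statements merged into one kernel-verified Lean document; each statement's English description precedes it below -/
import Mathlib

section
/- For every integer r ≥ 2 and every positive integer n, every ordered r-matching M of size n satisfies L(M) ≥ (1/(r−1))·n^{1/((r+1)·2^{r−2})}; equivalently, L_r(n) ≥ (1/(r−1))·n^{1/((r+1)·2^{r−2})}. -/
/-- An ordered `r`-matching of size `n`: a partition of `{1,…,r*n}` into `n`
edges, each of size `r`. -/
def IsOrderedMatching (r n : ℕ) (M : Finset (Finset ℕ)) : Prop :=
  M.card = n ∧ (∀ e ∈ M, e.card = r) ∧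
    (∀ e ∈ M, ∀ f ∈ M, e ≠ f → Disjoint e f) ∧
    M.biUnion id = Finset.Icc 1 (r * n)

/-- Two edges `e, f` form the pattern `P`: there is a strictly increasing map
on `e ∪ f` sending the pair `{e, f}` to the pair of edges of `P`. -/
def FormsPattern (e f : Finset ℕ) (P : Finset (Finset ℕ)) : Prop :=
  ∃ φ : ℕ → ℕ, StrictMonoOn φ (↑(e ∪ f) : Set ℕ) ∧
    ({e.image φ, f.image φ} : Finset (Finset ℕ)) = P

/-- An `r`-pattern: an ordered `r`-matching of size `2` (on `{1,…,2r}`). -/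
def IsPattern (r : ℕ) (P : Finset (Finset ℕ)) : Prop :=
  IsOrderedMatching r 2 P

/-- A collection of edges in which every pair of distinct edges forms `P`. -/
def IsPatternClique (P S : Finset (Finset ℕ)) : Prop :=
  ∀ e ∈ S, ∀ f ∈ S, e ≠ f → FormsPattern e f P

/-- `L_P(M)`: the maximum size of a sub-matching of `M` which is a `P`-clique. -/
noncomputable def cliqueSize (P M : Finset (Finset ℕ)) : ℕ :=
  sSup {k | ∃ S ⊆ M, IsPatternClique P S ∧ S.card = k}

/-- `L(M) = max_P L_P(M)`, the maximum over all `r`-patterns `P`. -/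
noncomputable def Lmax (r : ℕ) (M : Finset (Finset ℕ)) : ℕ :=
  sSup {k | ∃ P, IsPattern r P ∧ cliqueSize P M = k}

open Finset

namespace OrderedMatching

/-- In a transitive irreflexive relation whose chains have at most `k` elements, the heights
properly colour the relation with `k` colours. -/
theorem exists_coloring_of_chain_le {α : Type*} [DecidableEq α] (R : α → α → Prop)
    (C : Finset α) (k : ℕ) (irr : ∀ a ∈ C, ¬ R a a)
    (tr : ∀ a ∈ C, ∀ b ∈ C, ∀ c ∈ C, R a b → R b c → R a c)
    (hk : ∀ S ⊆ C, (∀ a ∈ S, ∀ b ∈ S, a ≠ b → R a b ∨ R b a) → S.card ≤ k) :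
    ∃ h : α → ℕ, (∀ a ∈ C, h a < k) ∧ ∀ a ∈ C, ∀ b ∈ C, R a b → h a ≠ h b := by
  classical
  let F : α → Finset (Finset α) := fun a => C.powerset.filter fun S =>
    (∀ x ∈ S, R x a) ∧ ∀ x ∈ S, ∀ y ∈ S, x ≠ y → R x y ∨ R y x
  have hF : ∀ a S, S ∈ F a ↔ S ⊆ C ∧ (∀ x ∈ S, R x a) ∧
      ∀ x ∈ S, ∀ y ∈ S, x ≠ y → R x y ∨ R y x := by
    intro a S
    simp [F]
  have key : ∀ a ∈ C, ∃ S ∈ F a, (F a).sup Finset.card = S.card := by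
    intro a _
    exact Finset.exists_mem_eq_sup _ ⟨∅, by simp [hF]⟩ _
  have hext : ∀ a ∈ C, ∀ S ∈ F a, (insert a S).card = S.card + 1 ∧ insert a S ⊆ C ∧
      ∀ x ∈ insert a S, ∀ y ∈ insert a S, x ≠ y → R x y ∨ R y x := by
    intro a ha S hS
    obtain ⟨h1, h2, h3⟩ := (hF a S).1 hS
    refine ⟨card_insert_of_notMem fun h => irr a ha (h2 a h), ?_, ?_⟩
    · exact insert_subset ha h1
    · intro x hx y hy hxy
      rcases mem_insert.1 hx with rfl | hx' <;> rcases mem_insert.1 hy with rfl | hy'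
      · exact absurd rfl hxy
      · exact Or.inr (h2 y hy')
      · exact Or.inl (h2 x hx')
      · exact h3 x hx' y hy' hxy
  refine ⟨fun a => (F a).sup Finset.card, ?_, ?_⟩
  · intro a ha
    obtain ⟨S, hS, hc⟩ := key a ha
    obtain ⟨h1, h2, h3⟩ := hext a ha S hS
    have := hk _ h2 h3
    simp only [hc]
    omega
  · intro a ha b hb hab
    obtain ⟨S, hS, hc⟩ := key a ha
    obtain ⟨h1, h2, h3⟩ := hext a ha S hS
    have : insert a S ∈ F b := by
      refine (hF _ _).2 ⟨h2, ?_, h3⟩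
      intro x hx
      rcases mem_insert.1 hx with rfl | hx
      · exact hab
      · exact tr x (h2 (mem_insert_of_mem hx)) a ha b hb (((hF a S).1 hS).2.1 x hx) hab
    have := Finset.le_sup (f := Finset.card) this
    simp only [hc]
    omega

/-- The sign of coordinate `i` when the sign changes exactly at the gaps outside `G`,
starting from a positive sign at coordinate `0`. -/
def IsPos (G : Finset ℕ) (i : ℕ) : Prop :=
  Even ((range i).filter (· ∉ G)).card

theorem isPos_zero (G : Finset ℕ) : IsPos G 0 := by
  simp [IsPos]

theorem isPos_succ_of_mem {G : Finset ℕ} {i : ℕ} (h : i ∈ G) : IsPos G (i + 1) ↔ IsPos G i := by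
  simp [IsPos, range_add_one, filter_insert, h]

theorem isPos_succ_of_notMem {G : Finset ℕ} {i : ℕ} (h : i ∉ G) :
    IsPos G (i + 1) ↔ ¬ IsPos G i := by
  simp [IsPos, range_add_one, filter_insert, h, Nat.even_add_one]

variable {α : Type*}

/-- The coordinates `x e i` and `x f i`, `i < r`, compare according to the signs given by `G`. -/
def EdgeLT (r : ℕ) (x : α → ℕ → ℕ) (G : Finset ℕ) (e f : α) : Prop :=
  ∀ i < r, (IsPos G i → x e i < x f i) ∧ (¬ IsPos G i → x f i < x e i)

/-- The intervals spanned by the coordinates `i` and `i + 1` of `e` and `f` are disjoint. -/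
def GapSep (x : α → ℕ → ℕ) (i : ℕ) (e f : α) : Prop :=
  x e (i + 1) < x f i ∨ x f (i + 1) < x e i

theorem GapSep.symm {x : α → ℕ → ℕ} {i : ℕ} {e f : α} (h : GapSep x i e f) : GapSep x i f e :=
  Or.symm h

theorem EdgeLT.irrefl {r : ℕ} (hr : 0 < r) {x : α → ℕ → ℕ} {G : Finset ℕ} {e : α} :
    ¬ EdgeLT r x G e e :=
  fun h => lt_irrefl _ ((h 0 hr).1 (isPos_zero G))

theorem EdgeLT.trans {r : ℕ} {x : α → ℕ → ℕ} {G : Finset ℕ} {e f g : α}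
    (h : EdgeLT r x G e f) (h' : EdgeLT r x G f g) : EdgeLT r x G e g :=
  fun i hi => ⟨fun hp => ((h i hi).1 hp).trans ((h' i hi).1 hp),
    fun hp => ((h' i hi).2 hp).trans ((h i hi).2 hp)⟩

theorem GapSep.mono {r : ℕ} {x : α → ℕ → ℕ} {G : Finset ℕ} {i : ℕ} (hi : i ∈ G) (hir : i + 1 < r)
    {a u v b : α} (hau : a = u ∨ EdgeLT r x G a u) (huv : EdgeLT r x G u v)
    (hvb : v = b ∨ EdgeLT r x G v b) (h : GapSep x i u v) : GapSep x i a b := by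
  have e := isPos_succ_of_mem hi
  have h1 := huv i (by omega)
  have h2 := huv (i + 1) hir
  by_cases hp : IsPos G i
  · have h1 := h1.1 hp
    have h2 := h2.1 (e.2 hp)
    have h3 : x a (i + 1) ≤ x u (i + 1) := by
      rcases hau with rfl | hau
      · rfl
      · exact ((hau (i + 1) hir).1 (e.2 hp)).le
    have h4 : x v i ≤ x b i := by
      rcases hvb with rfl | hvb
      · rfl
      · exact ((hvb i (by omega)).1 hp).le
    rcases h with h | h
    · left; omega
    · exact Or.inl (by omega)
  · have hp' : ¬ IsPos G (i + 1) := fun h => hp (e.1 h)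
    have h1 := h1.2 hp
    have h2 := h2.2 hp'
    have h3 : x u i ≤ x a i := by
      rcases hau with rfl | hau
      · rfl
      · exact ((hau i (by omega)).2 hp).le
    have h4 : x b (i + 1) ≤ x v (i + 1) := by
      rcases hvb with rfl | hvb
      · rfl
      · exact ((hvb (i + 1) hir).2 hp').le
    exact Or.inr (by rcases h with h | h <;> omega)

/-- Pairs in `C` are comparable with respect to `G`. -/
def IsSignChain (r : ℕ) (x : α → ℕ → ℕ) (G : Finset ℕ) (C : Finset α) : Prop :=
  ∀ e ∈ C, ∀ f ∈ C, e ≠ f → EdgeLT r x G e f ∨ EdgeLT r x G f e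

/-- Among the gaps in `G`, exactly those in `S` separate pairs of elements of `C`. -/
def IsGapHomogeneous (x : α → ℕ → ℕ) (G S : Finset ℕ) (C : Finset α) : Prop :=
  ∀ e ∈ C, ∀ f ∈ C, e ≠ f → ∀ i ∈ G, (GapSep x i e f ↔ i ∈ S)

theorem IsSignChain.mono {r : ℕ} {x : α → ℕ → ℕ} {G : Finset ℕ} {C D : Finset α}
    (h : IsSignChain r x G C) (hD : D ⊆ C) : IsSignChain r x G D :=
  fun e he f hf => h e (hD he) f (hD hf)

theorem IsSignChain.eq_or_edgeLT {r : ℕ} (hr : 0 < r) {x : α → ℕ → ℕ} {G : Finset ℕ}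
    {C : Finset α} (h : IsSignChain r x G C) {e f : α} (he : e ∈ C) (hf : f ∈ C)
    (hef : x e 0 ≤ x f 0) : e = f ∨ EdgeLT r x G e f := by
  by_cases heq : e = f
  · exact Or.inl heq
  · rcases h e he f hf heq with h | h
    · exact Or.inr h
    · have := (h 0 hr).1 (isPos_zero G)
      omega

theorem card_signChain_le [DecidableEq α] {r K : ℕ} (hr : 0 < r) (hK : 1 ≤ K) {x : α → ℕ → ℕ}
    {G : Finset ℕ} (hG : ∀ i ∈ G, i + 1 < r) {M : Finset α}
    (hhom : ∀ C ⊆ M, ∀ S, IsSignChain r x G C → IsGapHomogeneous x G S C → C.card ≤ K)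
    (T : Finset ℕ) (hT : T ⊆ G) (C : Finset α) (hCM : C ⊆ M) (hC : IsSignChain r x G C)
    (hopen : ∀ e ∈ C, ∀ f ∈ C, e ≠ f → ∀ i ∈ G, i ∉ T → ¬ GapSep x i e f) :
    C.card ≤ K ^ (1 + T.card) := by
  induction hc : T.card generalizing T C with
  | zero =>
    obtain rfl := card_eq_zero.1 hc
    rw [add_zero, pow_one]
    refine hhom C hCM ∅ hC fun e he f hf hef i hi => ?_
    simpa using hopen e he f hf hef i hi
  | succ t ih =>
    obtain ⟨h, hlt, hne⟩ := exists_coloring_of_chain_le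
      (fun e f => EdgeLT r x G e f ∧ ∀ i ∈ T, GapSep x i e f) C K
      (fun a _ h => EdgeLT.irrefl hr h.1)
      (fun a _ b _ c _ hab hbc => ⟨hab.1.trans hbc.1, fun i hi =>
        GapSep.mono (hT hi) (hG i (hT hi)) (Or.inl rfl) hab.1 (Or.inr hbc.1) (hab.2 i hi)⟩)
      (by
        intro S hS hch
        refine hhom S (hS.trans hCM) T (hC.mono hS) fun e he f hf hef i hi => ⟨?_, ?_⟩
        · intro hsep
          by_contra hiT
          exact hopen e (hS he) f (hS hf) hef i hi hiT hsep
        · intro hiT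
          rcases hch e he f hf hef with h | h
          · exact h.2 i hiT
          · exact (h.2 i hiT).symm)
    have hfib : ∀ k ∈ range K, (C.filter fun a => h a = k).card ≤ K ^ (1 + t) := by
      intro k _
      set W := C.filter fun a => h a = k with hW
      have hWC : W ⊆ C := filter_subset _ _
      rcases Nat.lt_or_ge 1 W.card with h1 | h1
      swap
      · exact h1.trans (Nat.one_le_pow _ _ hK)
      have hWne : W.Nonempty := card_pos.1 (by omega)
      have hWch := hC.mono hWC
      obtain ⟨a, ha, hmin⟩ := exists_min_image W (fun e => x e 0) hWne
      obtain ⟨b, hb, hmax⟩ := exists_max_image W (fun e => x e 0) hWne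
      have hab : EdgeLT r x G a b := by
        rcases hWch.eq_or_edgeLT hr ha hb (hmin b hb) with rfl | h
        · obtain ⟨c, hc, hca⟩ := exists_mem_ne h1 a
          rcases hWch.eq_or_edgeLT hr ha hc (hmin c hc) with rfl | h'
          · exact absurd rfl hca
          · have h2 := (h' 0 hr).1 (isPos_zero G)
            have h3 := hmax c hc
            omega
        · exact h
      have hnot : ∃ i ∈ T, ¬ GapSep x i a b := by
        by_contra! hall
        exact hne a (hWC ha) b (hWC hb) ⟨hab, hall⟩
          ((mem_filter.1 ha).2.trans (mem_filter.1 hb).2.symm)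
      obtain ⟨i, hiT, hiab⟩ := hnot
      have hopen' : ∀ e ∈ W, ∀ f ∈ W, EdgeLT r x G e f → ¬ GapSep x i e f :=
        fun e he f hf hef hsep => hiab (GapSep.mono (hT hiT) (hG i (hT hiT))
          (hWch.eq_or_edgeLT hr ha he (hmin e he)) hef
          (hWch.eq_or_edgeLT hr hf hb (hmax f hf)) hsep)
      refine ih (T.erase i) ((erase_subset _ _).trans hT) W (hWC.trans hCM) hWch ?_
        (by rw [card_erase_of_mem hiT]; omega)
      intro e he f hf hef j hj hjT
      by_cases hji : j = i
      · subst hji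
        rcases hWch e he f hf hef with h | h
        · exact hopen' e he f hf h
        · exact fun hs => hopen' f hf e he h hs.symm
      · exact hopen e (hWC he) f (hWC hf) hef j hj fun h => hjT (mem_erase.2 ⟨hji, h⟩)
    have := card_le_mul_card_image_of_maps_to (s := C) (t := range K) (f := h)
      (fun a ha => mem_range.2 (hlt a ha)) _ hfib
    rw [card_range] at this
    calc C.card ≤ K ^ (1 + t) * K := this
      _ = K ^ (1 + (t + 1)) := by ring

theorem exists_edgeLT {r : ℕ} {x : α → ℕ → ℕ} {e f : α} (hne : ∀ i < r, x e i ≠ x f i)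
    (h0 : x e 0 < x f 0) : ∃ G ∈ (range (r - 1)).powerset, EdgeLT r x G e f := by
  refine ⟨(range (r - 1)).filter fun i => x e i < x f i ↔ x e (i + 1) < x f (i + 1),
    mem_powerset.2 (filter_subset _ _), ?_⟩
  set G := (range (r - 1)).filter fun i => x e i < x f i ↔ x e (i + 1) < x f (i + 1) with hG
  have key : ∀ i < r, (IsPos G i ↔ x e i < x f i) := by
    intro i
    induction i with
    | zero => exact fun _ => ⟨fun _ => h0, fun _ => isPos_zero G⟩
    | succ i ih =>
      intro hi
      have ih := ih (by omega)
      by_cases hiG : i ∈ G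
      · rw [isPos_succ_of_mem hiG, ih]
        exact (mem_filter.1 hiG).2
      · rw [isPos_succ_of_notMem hiG, ih]
        have : ¬ (x e i < x f i ↔ x e (i + 1) < x f (i + 1)) := fun h =>
          hiG (mem_filter.2 ⟨mem_range.2 (by omega), h⟩)
        tauto
  intro i hi
  have := hne i hi
  rw [key i hi]
  exact ⟨id, fun h => by omega⟩

theorem sum_powerset_one_add_card (m : ℕ) :
    2 * ∑ G ∈ (range m).powerset, (1 + G.card) = (m + 2) * 2 ^ m := by
  have hc : ∀ m, ∑ G ∈ (range m).powerset, 1 = 2 ^ m := by simp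
  induction m with
  | zero => simp
  | succ m ih =>
    rw [range_add_one, sum_powerset_insert notMem_range_self]
    have : ∑ G ∈ (range m).powerset, (1 + (insert m G).card)
        = ∑ G ∈ (range m).powerset, ((1 + G.card) + 1) := by
      refine sum_congr rfl fun G hG => ?_
      rw [card_insert_of_notMem fun h => notMem_range_self (mem_powerset.1 hG h)]
      ring
    rw [this, sum_add_distrib (g := fun _ => 1), hc, mul_add, mul_add, ih]
    ring

theorem card_le_pow [DecidableEq α] {r K : ℕ} (hr : 2 ≤ r) (hK : 1 ≤ K) {x : α → ℕ → ℕ}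
    {M : Finset α} (hne : ∀ e ∈ M, ∀ f ∈ M, e ≠ f → ∀ i < r, x e i ≠ x f i)
    (hhom : ∀ G ⊆ range (r - 1), ∀ C ⊆ M, ∀ S, IsSignChain r x G C →
      IsGapHomogeneous x G S C → C.card ≤ K) :
    M.card ≤ K ^ ((r + 1) * 2 ^ (r - 2)) := by
  have hcol : ∀ G : Finset ℕ, ∃ h : α → ℕ, G ⊆ range (r - 1) →
      (∀ a ∈ M, h a < K ^ (1 + G.card)) ∧
      ∀ a ∈ M, ∀ b ∈ M, EdgeLT r x G a b → h a ≠ h b := by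
    intro G
    by_cases hG : G ⊆ range (r - 1)
    · obtain ⟨h, hh⟩ := exists_coloring_of_chain_le (EdgeLT r x G) M (K ^ (1 + G.card))
        (fun a _ => EdgeLT.irrefl (by omega)) (fun a _ b _ c _ => EdgeLT.trans)
        (fun S hS hch => card_signChain_le (by omega) hK
          (fun i hi => by have := mem_range.1 (hG hi); omega) (hhom G hG) G subset_rfl S hS hch
          (fun _ _ _ _ _ i hi hi' => absurd hi hi'))
      exact ⟨h, fun _ => hh⟩
    · exact ⟨fun _ => 0, fun h => absurd h hG⟩
  choose h hh using hcol
  have hinj : M.card ≤ ((range (r - 1)).powerset.pi fun G => range (K ^ (1 + G.card))).card := by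
    refine card_le_card_of_injOn (fun e G _ => h G e) ?_ ?_
    · intro e he
      simp only [mem_coe, mem_pi, mem_range]
      exact fun G hG => (hh G (mem_powerset.1 hG)).1 e he
    · intro e he f hf hef
      by_contra hne'
      have hx := hne e he f hf hne'
      have key : ∀ e ∈ M, ∀ f ∈ M, (∀ i < r, x e i ≠ x f i) → x e 0 < x f 0 →
          (fun (G : Finset ℕ) (_ : G ∈ (range (r - 1)).powerset) => h G e) ≠
            fun G _ => h G f := by
        intro e he f hf hx h0 heq
        obtain ⟨G, hG, hlt⟩ := exists_edgeLT hx h0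
        exact (hh G (mem_powerset.1 hG)).2 e he f hf hlt (congrFun (congrFun heq G) hG)
      rcases lt_or_gt_of_ne (hx 0 (by omega)) with h0 | h0
      · exact key e he f hf hx h0 hef
      · exact key f hf e he (fun i hi => (hx i hi).symm) h0 hef.symm
  rw [card_pi] at hinj
  simp only [card_range] at hinj
  rw [prod_pow_eq_pow_sum] at hinj
  obtain ⟨m, rfl⟩ := Nat.exists_eq_add_of_le hr
  have := sum_powerset_one_add_card (2 + m - 1)
  have e : ∑ G ∈ (range (2 + m - 1)).powerset, (1 + G.card) = (2 + m + 1) * 2 ^ (2 + m - 2) := by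
    have e1 : 2 + m - 1 = m + 1 := by omega
    have e2 : 2 + m - 2 = m := by omega
    rw [e1] at this ⊢
    rw [e2]
    rw [pow_succ] at this
    linarith
  rwa [e] at hinj

theorem lt_of_separated_run {r c : ℕ} {x : α → ℕ → ℕ} {G U : Finset ℕ} (hU : U ⊆ G)
    {z : Fin c → α} (hlt : ∀ a b, a < b → EdgeLT r x G (z a) (z b))
    (hsep : ∀ a b, a < b → ∀ i ∈ U, GapSep x i (z a) (z b)) (j : ℕ) :
    ∀ (a b : Fin c) (i : ℕ), (a : ℕ) + (j + 1) ≤ b → i + (j + 1) < r →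
      (∀ k, i ≤ k → k < i + (j + 1) → k ∈ U) →
      (IsPos G i → x (z a) (i + (j + 1)) < x (z b) i) ∧
      (¬ IsPos G i → x (z b) (i + (j + 1)) < x (z a) i) := by
  have base : ∀ a b : Fin c, a < b → ∀ i ∈ U, i + 1 < r →
      (IsPos G i → x (z a) (i + 1) < x (z b) i) ∧
      (¬ IsPos G i → x (z b) (i + 1) < x (z a) i) := by
    intro a b hab i hi hir
    have h1 := hlt a b hab i (by omega)
    have h2 := hlt a b hab (i + 1) hir
    rw [isPos_succ_of_mem (hU hi)] at h2
    have h3 := hsep a b hab i hi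
    refine ⟨fun hp => ?_, fun hp => ?_⟩
    · have := h1.1 hp
      have := h2.1 hp
      rcases h3 with h | h <;> omega
    · have := h1.2 hp
      have := h2.2 hp
      rcases h3 with h | h <;> omega
  induction j with
  | zero =>
    intro a b i hab hir hk
    exact base a b (by rw [Fin.lt_def]; omega) i (hk i le_rfl (by omega)) hir
  | succ j ih =>
    intro a b i hab hir hk
    have hiU := hk i le_rfl (by omega)
    have hb := b.2
    have e : i + (j + 1 + 1) = i + 1 + (j + 1) := by ring
    rw [e]
    have hpos := isPos_succ_of_mem (hU hiU)
    refine ⟨fun hp => ?_, fun hp => ?_⟩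
    · have hm : (b : ℕ) - 1 < c := by omega
      have h1 := (ih a ⟨b - 1, hm⟩ (i + 1) (by simp only; omega) (by omega)
        (fun k h h' => hk k (by omega) (by omega))).1 (hpos.2 hp)
      have h2 := (base ⟨b - 1, hm⟩ b (by rw [Fin.lt_def]; simp only; omega) i hiU (by omega)).1 hp
      exact h1.trans h2
    · have hm : (a : ℕ) + 1 < c := by omega
      have h1 := (ih ⟨a + 1, hm⟩ b (i + 1) (by simp only; omega) (by omega)
        (fun k h h' => hk k (by omega) (by omega))).2 (fun h => hp (hpos.1 h))
      have h2 := (base a ⟨a + 1, hm⟩ (by rw [Fin.lt_def]; simp) i hiU (by omega)).2 hp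
      exact h1.trans h2

/-- The relative order of coordinate `i` of the smaller edge and coordinate `j` of the larger one,
when the signs are given by `G` and the runs of gaps in `U` are separated. -/
def CoordLT (G U : Finset ℕ) (i j : ℕ) : Prop :=
  (i ≤ j ∧ (IsPos G i ∨ ∃ k, i ≤ k ∧ k < j ∧ k ∉ U)) ∨
    (j < i ∧ IsPos G j ∧ ∀ k, j ≤ k → k < i → k ∈ U)

theorem lt_iff_coordLT {r : ℕ} {x : α → ℕ → ℕ} {G U : Finset ℕ} {e f : α}
    (he : ∀ i j, i < j → j < r → x e i < x e j) (hf : ∀ i j, i < j → j < r → x f i < x f j)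
    (hlt : EdgeLT r x G e f) (hopen : ∀ k ∈ G, k ∉ U → ¬ GapSep x k e f)
    (hdis : ∀ k ∈ G, k ∉ U → k + 1 < r → x e k ≠ x f (k + 1) ∧ x f k ≠ x e (k + 1))
    (hrun : ∀ i j, i < j → j < r → (∀ k, i ≤ k → k < j → k ∈ U) →
      (IsPos G i → x e j < x f i) ∧ (¬ IsPos G i → x f j < x e i))
    {i j : ℕ} (hi : i < r) (hj : j < r) : x e i < x f j ↔ CoordLT G U i j := by
  have he' : ∀ i j, i ≤ j → j < r → x e i ≤ x e j := by
    intro i j hij hj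
    rcases hij.eq_or_lt with rfl | h
    · rfl
    · exact (he i j h hj).le
  have hf' : ∀ i j, i ≤ j → j < r → x f i ≤ x f j := by
    intro i j hij hj
    rcases hij.eq_or_lt with rfl | h
    · rfl
    · exact (hf i j h hj).le
  have cross : ∀ k, k ∉ U → k + 1 < r → x e k < x f (k + 1) ∧ x f k < x e (k + 1) := by
    intro k hkU hk
    have h1 := hlt k (by omega)
    have h2 := hlt (k + 1) hk
    have h3 := he k (k + 1) (by omega) hk
    have h4 := hf k (k + 1) (by omega) hk
    by_cases hkG : k ∈ G
    · have h5 := hopen k hkG hkU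
      have h6 := hdis k hkG hkU hk
      simp only [GapSep, not_or, not_lt] at h5
      omega
    · rw [isPos_succ_of_notMem hkG] at h2
      by_cases hp : IsPos G k
      · have := h1.1 hp
        have := h2.2 (fun h => h hp)
        omega
      · have := h1.2 hp
        have := h2.1 hp
        omega
  have hsign := hlt i hi
  rcases lt_trichotomy i j with hij | rfl | hij
  · by_cases hall : ∀ k, i ≤ k → k < j → k ∈ U
    · have h1 := hrun i j hij hj hall
      by_cases hp : IsPos G i
      · refine iff_of_true ((hsign.1 hp).trans (hf i j hij hj)) (Or.inl ⟨hij.le, Or.inl hp⟩)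
      · refine iff_of_false (h1.2 hp).not_gt ?_
        rintro (⟨_, h | ⟨k, h, h', h''⟩⟩ | ⟨h, _⟩)
        · exact hp h
        · exact h'' (hall k h h')
        · omega
    · push Not at hall
      obtain ⟨k, h1, h2, h3⟩ := hall
      refine iff_of_true ?_ (Or.inl ⟨hij.le, Or.inr ⟨k, h1, h2, h3⟩⟩)
      have a := he' i k h1 (by omega)
      have b := (cross k h3 (by omega)).1
      have c := hf' (k + 1) j h2 hj
      omega
  · by_cases hp : IsPos G i
    · exact iff_of_true (hsign.1 hp) (Or.inl ⟨le_rfl, Or.inl hp⟩)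
    · refine iff_of_false (hsign.2 hp).not_gt ?_
      rintro (⟨_, h | ⟨k, h, h', _⟩⟩ | ⟨h, _⟩)
      · exact hp h
      · omega
      · omega
  · by_cases hall : ∀ k, j ≤ k → k < i → k ∈ U
    · have h1 := hrun j i hij hi hall
      by_cases hp : IsPos G j
      · exact iff_of_true (h1.1 hp) (Or.inr ⟨hij, hp, hall⟩)
      · have a := (hlt j hj).2 hp
        have b := he j i hij hi
        refine iff_of_false (by omega) ?_
        rintro (⟨h, _⟩ | ⟨_, h, _⟩)
        · omega
        · exact hp h
    · have hall' := hall
      push Not at hall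
      obtain ⟨k, h1, h2, h3⟩ := hall
      have a := hf' j k h1 (by omega)
      have b := (cross k h3 (by omega)).2
      have c := he' (k + 1) i h2 hi
      refine iff_of_false (by omega) ?_
      rintro (⟨h, _⟩ | ⟨_, _, h⟩)
      · omega
      · exact hall' h

/-- Keeping every `(r - 1)`-th element of a homogeneous chain fixes the relative order
of all coordinates. -/
theorem exists_uniform_subset [DecidableEq α] {r : ℕ} (hr : 2 ≤ r) {x : α → ℕ → ℕ}
    {G S : Finset ℕ} (hG : G ⊆ range (r - 1)) {C : Finset α}
    (hmono : ∀ e ∈ C, ∀ i j, i < j → j < r → x e i < x e j)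
    (hne : ∀ e ∈ C, ∀ f ∈ C, e ≠ f → ∀ i < r, ∀ j < r, x e i ≠ x f j)
    (hC : IsSignChain r x G C) (hS : IsGapHomogeneous x G S C) :
    ∃ Q ⊆ C, C.card ≤ (r - 1) * Q.card ∧ ∃ D : ℕ → ℕ → Prop, ∀ e ∈ Q, ∀ f ∈ Q, e ≠ f →
      (∀ i < r, ∀ j < r, x e i < x f j ↔ D i j) ∨
      (∀ i < r, ∀ j < r, x f i < x e j ↔ D i j) := by
  have hinj : Set.InjOn (fun e => x e 0) (C : Set α) := by
    intro e he f hf hef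
    by_contra h
    exact hne e he f hf h 0 (by omega) 0 (by omega) hef
  have hcard : (C.image fun e => x e 0).card = C.card := card_image_of_injOn hinj
  have hex : ∀ a : Fin C.card, ∃ e ∈ C, x e 0 = (C.image fun e => x e 0).orderEmbOfFin hcard a :=
    fun a => mem_image.1 (orderEmbOfFin_mem _ hcard a)
  choose z hzC hz using hex
  have hz0 : ∀ a b, a < b → x (z a) 0 < x (z b) 0 := by
    intro a b hab
    rw [hz, hz]
    exact (OrderEmbedding.lt_iff_lt _).2 hab
  have hzne : ∀ a b, a < b → z a ≠ z b := fun a b hab h => by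
    have := hz0 a b hab
    rw [h] at this
    exact lt_irrefl _ this
  have hlt : ∀ a b, a < b → EdgeLT r x G (z a) (z b) := fun a b hab =>
    (hC.eq_or_edgeLT (by omega) (hzC a) (hzC b) (hz0 a b hab).le).resolve_left (hzne a b hab)
  set U := G ∩ S with hU
  have hUG : U ⊆ G := inter_subset_left
  have hsep : ∀ a b, a < b → ∀ i ∈ U, GapSep x i (z a) (z b) := fun a b hab i hi =>
    (hS _ (hzC a) _ (hzC b) (hzne a b hab) i (mem_inter.1 hi).1).2 (mem_inter.1 hi).2
  have huni : ∀ a b : Fin C.card, (a : ℕ) + (r - 1) ≤ b → ∀ i < r, ∀ j < r,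
      (x (z a) i < x (z b) j ↔ CoordLT G U i j) := by
    intro a b hab i hi j hj
    have hab' : a < b := by rw [Fin.lt_def]; omega
    have hn := hne _ (hzC a) _ (hzC b) (hzne a b hab')
    refine lt_iff_coordLT (hmono _ (hzC a)) (hmono _ (hzC b)) (hlt a b hab') ?_ ?_ ?_ hi hj
    · intro k hk hkU hs
      exact hkU (mem_inter.2 ⟨hk, (hS _ (hzC a) _ (hzC b) (hzne a b hab') k hk).1 hs⟩)
    · exact fun k _ _ hk => ⟨hn k (by omega) _ hk, (hn _ hk k (by omega)).symm⟩
    · intro i j hij hj hk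
      obtain ⟨d, rfl⟩ := Nat.exists_eq_add_of_lt hij
      exact lt_of_separated_run hUG hlt hsep d a b i (by omega) hj hk
  obtain ⟨d, rfl⟩ : ∃ d, r = d + 2 := ⟨r - 2, by omega⟩
  have hd : d + 2 - 1 = d + 1 := by omega
  rw [hd] at huni ⊢
  set q := (C.card + d) / (d + 1) with hq
  have hlt_card : ∀ t : Fin q, (t : ℕ) * (d + 1) < C.card := by
    intro t
    have h1 : (t : ℕ) + 1 ≤ (C.card + d) / (d + 1) := t.2
    rw [Nat.le_div_iff_mul_le (by omega)] at h1
    have : ((t : ℕ) + 1) * (d + 1) = t * (d + 1) + (d + 1) := by ring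
    omega
  let y : Fin q → α := fun t => z ⟨t * (d + 1), hlt_card t⟩
  have hstep : ∀ s t : Fin q, s < t → (s : ℕ) * (d + 1) + (d + 1) ≤ t * (d + 1) := by
    intro s t hst
    have : ((s : ℕ) + 1) * (d + 1) ≤ t * (d + 1) := Nat.mul_le_mul_right _ hst
    linarith
  have hyinj : Function.Injective y := by
    intro s t hst
    by_contra hne'
    rcases lt_or_gt_of_ne hne' with h | h
    · exact hzne _ _ (by rw [Fin.lt_def]; have := hstep s t h; simp only; omega) hst
    · exact hzne _ _ (by rw [Fin.lt_def]; have := hstep t s h; simp only; omega) hst.symm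
  refine ⟨univ.image y, ?_, ?_, CoordLT G U, ?_⟩
  · intro e he
    obtain ⟨t, _, rfl⟩ := mem_image.1 he
    exact hzC _
  · rw [card_image_of_injective _ hyinj, card_univ, Fintype.card_fin]
    have := Nat.lt_mul_div_succ (C.card + d) (show 0 < d + 1 by omega)
    rw [← hq, mul_add] at this
    omega
  · intro e he f hf hef
    obtain ⟨s, _, rfl⟩ := mem_image.1 he
    obtain ⟨t, _, rfl⟩ := mem_image.1 hf
    rcases lt_trichotomy s t with h | rfl | h
    · exact Or.inl (huni _ _ (hstep s t h))
    · exact absurd rfl hef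
    · exact Or.inr (huni _ _ (hstep t s h))

/-- The number of elements of `A` up to `v`. -/
def rankIn (A : Finset ℕ) (v : ℕ) : ℕ := (A.filter (· ≤ v)).card

theorem rankIn_strictMonoOn (A : Finset ℕ) : StrictMonoOn (rankIn A) (A : Set ℕ) := by
  intro v _ w hw hvw
  refine card_lt_card ⟨fun u hu => ?_, fun h => ?_⟩
  · rw [mem_filter] at hu ⊢
    exact ⟨hu.1, hu.2.trans hvw.le⟩
  · have := (mem_filter.1 (h (mem_filter.2 ⟨hw, le_rfl⟩))).2
    omega

theorem image_rankIn (A : Finset ℕ) : A.image (rankIn A) = Icc 1 A.card := by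
  refine eq_of_subset_of_card_le ?_ ?_
  · intro k hk
    obtain ⟨v, hv, rfl⟩ := mem_image.1 hk
    exact mem_Icc.2 ⟨card_pos.2 ⟨v, mem_filter.2 ⟨hv, le_rfl⟩⟩, card_filter_le _ _⟩
  · rw [card_image_of_injOn (rankIn_strictMonoOn A).injOn]
    simp

/-- The pattern formed by two edges. -/
def pairPattern (e f : Finset ℕ) : Finset (Finset ℕ) :=
  {e.image (rankIn (e ∪ f)), f.image (rankIn (e ∪ f))}

theorem formsPattern_pairPattern (e f : Finset ℕ) : FormsPattern e f (pairPattern e f) :=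
  ⟨rankIn (e ∪ f), rankIn_strictMonoOn _, rfl⟩

theorem isPattern_pairPattern {r : ℕ} (hr : 0 < r) {e f : Finset ℕ} (he : e.card = r)
    (hf : f.card = r) (hef : Disjoint e f) : IsPattern r (pairPattern e f) := by
  have hinj := (rankIn_strictMonoOn (e ∪ f)).injOn
  have hce : (e.image (rankIn (e ∪ f))).card = r := by
    rw [card_image_of_injOn (hinj.mono (by simp)), he]
  have hcf : (f.image (rankIn (e ∪ f))).card = r := by
    rw [card_image_of_injOn (hinj.mono (by simp)), hf]
  have hdis : Disjoint (e.image (rankIn (e ∪ f))) (f.image (rankIn (e ∪ f))) := by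
    rw [disjoint_left]
    intro k hk hk'
    obtain ⟨v, hv, rfl⟩ := mem_image.1 hk
    obtain ⟨w, hw, hwv⟩ := mem_image.1 hk'
    have : w = v := hinj (by simp [hw]) (by simp [hv]) hwv
    exact disjoint_left.1 hef hv (this ▸ hw)
  refine ⟨card_pair fun h => ?_, ?_, ?_, ?_⟩
  · rw [← h, disjoint_self, bot_eq_empty] at hdis
    rw [hdis, card_empty] at hce
    omega
  · intro g hg
    rcases mem_insert.1 hg with rfl | hg
    · exact hce
    · rw [mem_singleton.1 hg, hcf]
  · intro g hg g' hg' hne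
    simp only [pairPattern, mem_insert, mem_singleton] at hg hg'
    rcases hg with rfl | rfl <;> rcases hg' with rfl | rfl
    · exact absurd rfl hne
    · exact hdis
    · exact hdis.symm
    · exact absurd rfl hne
  · rw [pairPattern, biUnion_insert, singleton_biUnion, id, id, ← image_union, image_rankIn,
      card_union_of_disjoint hef, he, hf, mul_two]

theorem rankIn_union_image {r : ℕ} {a b : ℕ → ℕ} (ha : Set.InjOn a (range r))
    (hb : Set.InjOn b (range r)) (hab : ∀ i < r, ∀ j < r, a i ≠ b j) (v : ℕ) :
    rankIn ((range r).image a ∪ (range r).image b) v =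
      ((range r).filter fun k => a k ≤ v).card + ((range r).filter fun k => b k ≤ v).card := by
  rw [rankIn, filter_union, card_union_of_disjoint, filter_image, filter_image,
    card_image_of_injOn (ha.mono (by simp [Set.subset_def]; tauto)),
    card_image_of_injOn (hb.mono (by simp [Set.subset_def]; tauto))]
  rw [disjoint_left]
  intro k hk hk'
  obtain ⟨i, hi, rfl⟩ := mem_image.1 (mem_filter.1 hk).1
  obtain ⟨j, hj, h⟩ := mem_image.1 (mem_filter.1 hk').1
  exact hab i (mem_range.1 hi) j (mem_range.1 hj) h.symm

theorem pairPattern_congr {r : ℕ} {a b a' b' : ℕ → ℕ}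
    (ha : StrictMonoOn a (range r)) (hb : StrictMonoOn b (range r))
    (ha' : StrictMonoOn a' (range r)) (hb' : StrictMonoOn b' (range r))
    (hab : ∀ i < r, ∀ j < r, a i ≠ b j) (hab' : ∀ i < r, ∀ j < r, a' i ≠ b' j)
    (h : ∀ i < r, ∀ j < r, a i < b j ↔ a' i < b' j) :
    pairPattern ((range r).image a) ((range r).image b) =
      pairPattern ((range r).image a') ((range r).image b') := by
  have h1 : ((range r).image a).image (rankIn ((range r).image a ∪ (range r).image b)) =
      ((range r).image a').image (rankIn ((range r).image a' ∪ (range r).image b')) := by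
    rw [image_image, image_image]
    refine image_congr fun i hi => ?_
    simp only [Function.comp]
    rw [rankIn_union_image ha.injOn hb.injOn hab, rankIn_union_image ha'.injOn hb'.injOn hab']
    congr 2
    · refine filter_congr fun k hk => ?_
      rw [ha.le_iff_le hk hi, ha'.le_iff_le hk hi]
    · refine filter_congr fun k hk => ?_
      rw [← not_lt, ← not_lt, h i (mem_range.1 hi) k (mem_range.1 hk)]
  have h2 : ((range r).image b).image (rankIn ((range r).image a ∪ (range r).image b)) =
      ((range r).image b').image (rankIn ((range r).image a' ∪ (range r).image b')) := by
    rw [image_image, image_image]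
    refine image_congr fun i hi => ?_
    simp only [Function.comp]
    rw [rankIn_union_image ha.injOn hb.injOn hab, rankIn_union_image ha'.injOn hb'.injOn hab']
    have hi' := mem_range.1 hi
    congr 2
    · refine filter_congr fun k hk => ?_
      have hk' := mem_range.1 hk
      rw [(hab k hk' i hi').le_iff_lt, (hab' k hk' i hi').le_iff_lt, h k hk' i hi']
    · refine filter_congr fun k hk => ?_
      rw [hb.le_iff_le hk hi, hb'.le_iff_le hk hi]
  rw [pairPattern, pairPattern, h1, h2]

theorem FormsPattern.symm {e f : Finset ℕ} {P : Finset (Finset ℕ)} (h : FormsPattern e f P) :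
    FormsPattern f e P := by
  obtain ⟨φ, hφ, rfl⟩ := h
  exact ⟨φ, by rwa [union_comm], pair_comm _ _⟩

theorem card_le_cliqueSize {P M Q : Finset (Finset ℕ)} (hQ : Q ⊆ M) (h : IsPatternClique P Q) :
    Q.card ≤ cliqueSize P M := by
  refine le_csSup ⟨M.card, ?_⟩ ⟨Q, hQ, h, rfl⟩
  rintro k ⟨S, hS, _, rfl⟩
  exact card_le_card hS

theorem cliqueSize_le_card (P M : Finset (Finset ℕ)) : cliqueSize P M ≤ M.card := by
  refine csSup_le ⟨0, ∅, empty_subset _, by simp [IsPatternClique], rfl⟩ ?_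
  rintro k ⟨S, hS, _, rfl⟩
  exact card_le_card hS

theorem card_le_Lmax {r : ℕ} {P M Q : Finset (Finset ℕ)} (hP : IsPattern r P) (hQ : Q ⊆ M)
    (h : IsPatternClique P Q) : Q.card ≤ Lmax r M := by
  refine (card_le_cliqueSize hQ h).trans (le_csSup ⟨M.card, ?_⟩ ⟨P, hP, rfl⟩)
  rintro k ⟨P, _, rfl⟩
  exact cliqueSize_le_card P M

theorem exists_isPattern {r : ℕ} (hr : 0 < r) : ∃ P, IsPattern r P := by
  refine ⟨_, isPattern_pairPattern hr (e := Ico 0 r) (f := Ico r (2 * r)) (by simp)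
    (by simp; omega) ?_⟩
  rw [disjoint_left]
  intro k hk hk'
  rw [mem_Ico] at hk hk'
  omega

theorem card_le_Lmax_of_card_le_one {r : ℕ} (hr : 0 < r) {M Q : Finset (Finset ℕ)} (hQ : Q ⊆ M)
    (h : Q.card ≤ 1) : Q.card ≤ Lmax r M := by
  obtain ⟨P, hP⟩ := exists_isPattern hr
  exact card_le_Lmax hP hQ fun e he f hf hef => absurd (card_le_one.1 h e he f hf) hef

theorem nth_strictMonoOn (e : Finset ℕ) :
    StrictMonoOn (Nat.nth (· ∈ e)) (range e.card) := by
  intro i _ j hj hij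
  refine Nat.nth_lt_nth_of_lt_card e.finite_toSet hij ?_
  simpa using hj

theorem image_nth (e : Finset ℕ) : (range e.card).image (Nat.nth (· ∈ e)) = e := by
  refine eq_of_subset_of_card_le ?_ ?_
  · intro v hv
    obtain ⟨i, hi, rfl⟩ := mem_image.1 hv
    exact Nat.nth_mem_of_lt_card e.finite_toSet (by simpa using hi)
  · rw [card_image_of_injOn (nth_strictMonoOn e).injOn, card_range]

theorem card_le_mul_Lmax {r : ℕ} (hr : 2 ≤ r) {M : Finset (Finset ℕ)}
    (hcard : ∀ e ∈ M, e.card = r) (hdis : ∀ e ∈ M, ∀ f ∈ M, e ≠ f → Disjoint e f)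
    {G S : Finset ℕ} (hG : G ⊆ range (r - 1)) {C : Finset (Finset ℕ)} (hCM : C ⊆ M)
    (hmono : ∀ e ∈ M, StrictMonoOn (Nat.nth (· ∈ e)) (range r))
    (hne : ∀ e ∈ M, ∀ f ∈ M, e ≠ f → ∀ i < r, ∀ j < r, Nat.nth (· ∈ e) i ≠ Nat.nth (· ∈ f) j)
    (hC : IsSignChain r (fun e => Nat.nth (· ∈ e)) G C)
    (hS : IsGapHomogeneous (fun e => Nat.nth (· ∈ e)) G S C) :
    C.card ≤ (r - 1) * Lmax r M := by
  obtain ⟨Q, hQC, hQ, D, hD⟩ := exists_uniform_subset hr hG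
    (fun e he i j hij hj => hmono e (hCM he) (by simp; omega) (by simpa using hj) hij)
    (fun e he f hf => hne e (hCM he) f (hCM hf)) hC hS
  refine hQ.trans (Nat.mul_le_mul_left _ ?_)
  have hQM := hQC.trans hCM
  rcases Nat.lt_or_ge 1 Q.card with h1 | h1
  swap
  · exact card_le_Lmax_of_card_le_one (by omega) hQM h1
  have himg : ∀ e ∈ M, (range r).image (Nat.nth (· ∈ e)) = e := by
    intro e he
    have := image_nth e
    rwa [hcard e he] at this
  obtain ⟨e₀, he₀, f₀, hf₀, hne₀, hord₀⟩ : ∃ e ∈ Q, ∃ f ∈ Q, e ≠ f ∧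
      ∀ i < r, ∀ j < r, Nat.nth (· ∈ e) i < Nat.nth (· ∈ f) j ↔ D i j := by
    obtain ⟨e, he, f, hf, hef⟩ := one_lt_card.1 h1
    rcases hD e he f hf hef with h | h
    · exact ⟨e, he, f, hf, hef, h⟩
    · exact ⟨f, hf, e, he, hef.symm, h⟩
  have hforms : ∀ e ∈ Q, ∀ f ∈ Q, e ≠ f →
      (∀ i < r, ∀ j < r, Nat.nth (· ∈ e) i < Nat.nth (· ∈ f) j ↔ D i j) →
      FormsPattern e f (pairPattern e₀ f₀) := by
    intro e he f hf hef hord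
    have := pairPattern_congr (hmono e (hQM he)) (hmono f (hQM hf)) (hmono e₀ (hQM he₀))
      (hmono f₀ (hQM hf₀)) (hne e (hQM he) f (hQM hf) hef) (hne e₀ (hQM he₀) f₀ (hQM hf₀) hne₀)
      (fun i hi j hj => (hord i hi j hj).trans (hord₀ i hi j hj).symm)
    rw [himg e (hQM he), himg f (hQM hf), himg e₀ (hQM he₀), himg f₀ (hQM hf₀)] at this
    rw [← this]
    exact formsPattern_pairPattern e f
  refine card_le_Lmax (isPattern_pairPattern (by omega) (hcard e₀ (hQM he₀)) (hcard f₀ (hQM hf₀))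
    (hdis e₀ (hQM he₀) f₀ (hQM hf₀) hne₀)) hQM fun e he f hf hef => ?_
  rcases hD e he f hf hef with h | h
  · exact hforms e he f hf hef h
  · exact FormsPattern.symm (hforms f hf e he hef.symm h)

end OrderedMatching

/-- **Lower bound in Theorem 1.1.** For every `r ≥ 2` and `n ≥ 1`, every
ordered `r`-matching `M` of size `n` satisfies
`L(M) ≥ (1/(r-1)) · n^(1/((r+1)·2^(r-2)))`. -/
theorem ramsey_lower_bound (r n : ℕ) (hr : 2 ≤ r) (hn : 1 ≤ n)
    (M : Finset (Finset ℕ)) (hM : IsOrderedMatching r n M) :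
    (1 / ((r : ℝ) - 1)) * (n : ℝ) ^ ((1 : ℝ) / (((r : ℝ) + 1) * (2 : ℝ) ^ (r - 2)))
      ≤ (Lmax r M : ℝ) := by
  obtain ⟨hMn, hcard, hdis, -⟩ := hM
  have hmono : ∀ e ∈ M, StrictMonoOn (Nat.nth (· ∈ e)) (Finset.range r) := by
    intro e he
    have := OrderedMatching.nth_strictMonoOn e
    rwa [hcard e he] at this
  have hne : ∀ e ∈ M, ∀ f ∈ M, e ≠ f → ∀ i < r, ∀ j < r,
      Nat.nth (· ∈ e) i ≠ Nat.nth (· ∈ f) j := by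
    intro e he f hf hef i hi j hj h
    have h1 : Nat.nth (· ∈ e) i ∈ e :=
      Nat.nth_mem_of_lt_card e.finite_toSet (by simpa [hcard e he] using hi)
    have h2 : Nat.nth (· ∈ f) j ∈ f :=
      Nat.nth_mem_of_lt_card f.finite_toSet (by simpa [hcard f hf] using hj)
    exact Finset.disjoint_left.1 (hdis e he f hf hef) h1 (h ▸ h2)
  obtain ⟨e, he⟩ : M.Nonempty := Finset.card_pos.1 (by omega)
  have hL : 1 ≤ Lmax r M := by
    simpa using OrderedMatching.card_le_Lmax_of_card_le_one (r := r) (by omega)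
      (Finset.singleton_subset_iff.2 he) (by simp)
  have hK : 1 ≤ (r - 1) * Lmax r M := Nat.mul_pos (by omega) hL
  have hn_le := OrderedMatching.card_le_pow hr hK (x := fun e => Nat.nth (· ∈ e))
    (fun e he f hf hef i hi => hne e he f hf hef i hi i hi)
    (fun G hG C hC S h1 h2 =>
      OrderedMatching.card_le_mul_Lmax hr hcard hdis hG hC hmono hne h1 h2)
  rw [hMn] at hn_le
  have hr1 : (0 : ℝ) < (r : ℝ) - 1 := by
    have : (2 : ℝ) ≤ r := by exact_mod_cast hr
    linarith
  have hE : (((r + 1) * 2 ^ (r - 2) : ℕ) : ℝ) = ((r : ℝ) + 1) * (2 : ℝ) ^ (r - 2) := by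
    push_cast
    ring
  have hKr : (((r - 1) * Lmax r M : ℕ) : ℝ) = ((r : ℝ) - 1) * (Lmax r M : ℝ) := by
    rw [Nat.cast_mul, Nat.cast_sub (by omega), Nat.cast_one]
  rw [one_div_mul_eq_div, div_le_iff₀' hr1, ← hKr, ← hE, one_div]
  refine (Real.rpow_le_rpow (by positivity) (Nat.cast_le (α := ℝ).2 hn_le)
    (by positivity)).trans ?_
  rw [Nat.cast_pow, Real.pow_rpow_inv_natCast (by positivity) (by positivity)]
end

section
/- For every integer r ≥ 2 and every positive integer n, there exists an ordered r-matching M of size n with L(M) ≤ ⌈n^{1/(2^r−1)}⌉; equivalently, L_r(n) ≤ ⌈n^{1/(2^r−1)}⌉. -/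
theorem exists_strictMonoOn_image_eq_Icc {α : Type*} [LinearOrder α] (K : Finset α) :
    ∃ g : α → ℕ, StrictMonoOn g (K : Set α) ∧ K.image g = Finset.Icc 1 K.card := by
  classical
  have hmono : StrictMonoOn (fun t => (K.filter (· ≤ t)).card) (K : Set α) := by
    intro s _ t ht hst
    apply Finset.card_lt_card
    rw [Finset.ssubset_iff_of_subset]
    · exact ⟨t, by simpa using ht, by simp [hst]⟩
    · intro u hu
      simp only [Finset.mem_filter] at hu ⊢
      exact ⟨hu.1, hu.2.trans hst.le⟩
  refine ⟨_, hmono, Finset.eq_of_subset_of_card_le ?_ ?_⟩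
  · intro k hk
    obtain ⟨t, ht, rfl⟩ := Finset.mem_image.1 hk
    rw [Finset.mem_Icc]
    exact ⟨Finset.card_pos.2 ⟨t, by simp [ht]⟩, Finset.card_filter_le _ _⟩
  · rw [Finset.card_image_of_injOn hmono.injOn]
    simp

theorem FormsPattern.lt_iff_lt_or {r : ℕ} {a b a' b' : Fin r → ℕ} (ha : StrictMono a)
    (hb : StrictMono b) (ha' : StrictMono a') (hb' : StrictMono b') {P : Finset (Finset ℕ)}
    (h : FormsPattern (Finset.univ.image a) (Finset.univ.image b) P)
    (h' : FormsPattern (Finset.univ.image a') (Finset.univ.image b') P) :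
    (∀ i j, a i < b j ↔ a' i < b' j) ∨ (∀ i j, a i < b j ↔ b' i < a' j) := by
  obtain ⟨φ, hφ, hP⟩ := h
  obtain ⟨ψ, hψ, hP'⟩ := h'
  have ma : ∀ i, a i ∈ (↑(Finset.univ.image a ∪ Finset.univ.image b) : Set ℕ) := by
    intro i; simp
  have mb : ∀ i, b i ∈ (↑(Finset.univ.image a ∪ Finset.univ.image b) : Set ℕ) := by
    intro i; simp
  have ma' : ∀ i, a' i ∈ (↑(Finset.univ.image a' ∪ Finset.univ.image b') : Set ℕ) := by
    intro i; simp
  have mb' : ∀ i, b' i ∈ (↑(Finset.univ.image a' ∪ Finset.univ.image b') : Set ℕ) := by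
    intro i; simp
  have sa : StrictMono (φ ∘ a) := fun i j hij => hφ (ma i) (ma j) (ha hij)
  have sb : StrictMono (φ ∘ b) := fun i j hij => hφ (mb i) (mb j) (hb hij)
  have sa' : StrictMono (ψ ∘ a') := fun i j hij => hψ (ma' i) (ma' j) (ha' hij)
  have sb' : StrictMono (ψ ∘ b') := fun i j hij => hψ (mb' i) (mb' j) (hb' hij)
  have key : ∀ u v : Fin r → ℕ, StrictMono u → StrictMono v →
      Finset.univ.image u = Finset.univ.image v → ∀ i, u i = v i := by
    intro u v hu hv huv i
    have : Set.range u = Set.range v := by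
      simpa using congrArg (fun s : Finset ℕ => (s : Set ℕ)) huv
    rw [(hu.range_inj hv).1 this]
  have hpair := hP.trans hP'.symm
  simp only [Finset.image_image] at hpair
  have hpair' := congrArg (fun s : Finset (Finset ℕ) => (s : Set (Finset ℕ))) hpair
  simp only [Finset.coe_pair] at hpair'
  rcases Set.pair_eq_pair_iff.1 hpair' with ⟨h1, h2⟩ | ⟨h1, h2⟩
  · left
    intro i j
    rw [← hφ.lt_iff_lt (ma i) (mb j), ← hψ.lt_iff_lt (ma' i) (mb' j)]
    have e1 := key _ _ sa sa' h1 i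
    have e2 := key _ _ sb sb' h2 j
    simp only [Function.comp_apply] at e1 e2
    rw [e1, e2]
  · right
    intro i j
    rw [← hφ.lt_iff_lt (ma i) (mb j), ← hψ.lt_iff_lt (mb' i) (ma' j)]
    have e1 := key _ _ sa sb' h1 i
    have e2 := key _ _ sb sa' h2 j
    simp only [Function.comp_apply] at e1 e2
    rw [e1, e2]

/-- The key of the `i`-th vertex of the edge indexed by `x`; vertices are ordered by comparing keys
lexicographically. The digit at `c` records first the part of `i` in the composition
`1 + ⋯ + 1 + (r - k)` with `k = log₂ (c + 1)`, and then `x c`, reversed when the binary digit of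
`c + 1` at that part is zero. -/
def vertexKey {N m : ℕ} (x : Fin N → Fin m) (i : ℕ) : Lex (Fin N → ℕ) :=
  toLex fun c => m * min i (Nat.log 2 (c + 1)) +
    if (c.val + 1).testBit (min i (Nat.log 2 (c + 1))) then (x c).val else (x c).rev.val

section vertexKey

variable {N m : ℕ} {x y : Fin N → Fin m} {c d : Fin N} {i j : ℕ}

theorem vertexKey_apply_eq (hx : x c = y c)
    (hij : min i (Nat.log 2 (c + 1)) = min j (Nat.log 2 (c + 1))) :
    ofLex (vertexKey x i) c = ofLex (vertexKey y j) c := by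
  simp only [vertexKey, ofLex_toLex, hx, hij]

theorem vertexKey_apply_lt (hij : min i (Nat.log 2 (c + 1)) < min j (Nat.log 2 (c + 1))) :
    ofLex (vertexKey x i) c < ofLex (vertexKey y j) c := by
  simp only [vertexKey, ofLex_toLex]
  generalize min i (Nat.log 2 (c + 1)) = p at *
  generalize min j (Nat.log 2 (c + 1)) = q at *
  have h1 : (if (c.val + 1).testBit p then (x c).val else (x c).rev.val) < m := by
    split_ifs
    · exact (x c).2
    · exact (x c).rev.2
  have h2 : m * (p + 1) ≤ m * q := Nat.mul_le_mul_left m hij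
  rw [mul_add, mul_one] at h2
  omega

theorem vertexKey_lt_of_min_lt (hxy : ∀ d < c, x d = y d)
    (hij : min i (Nat.log 2 (c + 1)) < min j (Nat.log 2 (c + 1))) :
    vertexKey x i < vertexKey y j := by
  have hlt : i < j := by
    by_contra! h
    exact absurd hij (not_lt.2 (min_le_min_right _ h))
  obtain ⟨d, hd, hmin⟩ := WellFounded.has_min (wellFounded_lt (α := Fin N))
    {d | min i (Nat.log 2 (d + 1)) < min j (Nat.log 2 (d + 1))} ⟨c, hij⟩
  have hdc : d ≤ c := not_lt.1 (hmin c hij)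
  refine ⟨d, fun e he => ?_, vertexKey_apply_lt hd⟩
  refine vertexKey_apply_eq (hxy e (he.trans_le hdc)) (le_antisymm ?_ ?_)
  · exact min_le_min_right _ hlt.le
  · exact not_lt.1 fun h => hmin e h he

theorem vertexKey_lt_of_min_eq (hxy : ∀ d < c, x d = y d) (hc : x c < y c)
    (hij : min i (Nat.log 2 (c + 1)) = min j (Nat.log 2 (c + 1))) :
    if (c.val + 1).testBit (min i (Nat.log 2 (c + 1))) then vertexKey x i < vertexKey y j
      else vertexKey y j < vertexKey x i := by
  have hpre : ∀ d < c, ofLex (vertexKey x i) d = ofLex (vertexKey y j) d := by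
    intro d hd
    refine vertexKey_apply_eq (hxy d hd) ?_
    have hle : Nat.log 2 (d + 1) ≤ Nat.log 2 (c + 1) :=
      Nat.log_mono_right (Nat.succ_le_succ hd.le)
    omega
  have hc' : (x c).val < (y c).val := hc
  split_ifs with hb
  · refine ⟨c, hpre, ?_⟩
    change ofLex (vertexKey x i) c < ofLex (vertexKey y j) c
    simp only [vertexKey, ofLex_toLex, ← hij, hb, if_true]
    omega
  · refine ⟨c, fun d hd => (hpre d hd).symm, ?_⟩
    change ofLex (vertexKey y j) c < ofLex (vertexKey x i) c
    simp only [vertexKey, ofLex_toLex, ← hij, hb, Fin.val_rev]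
    have := (y c).2
    simp only [Bool.false_eq_true, if_false]
    omega

theorem vertexKey_lt_iff (hxy : ∀ d < c, x d = y d) (hc : x c < y c) :
    vertexKey x i < vertexKey y j ↔
      min i (Nat.log 2 (c + 1)) < min j (Nat.log 2 (c + 1)) ∨
        min i (Nat.log 2 (c + 1)) = min j (Nat.log 2 (c + 1)) ∧
          (c.val + 1).testBit (min i (Nat.log 2 (c + 1))) = true := by
  rcases lt_trichotomy (min i (Nat.log 2 (c + 1))) (min j (Nat.log 2 (c + 1))) with h | h | h
  · simp [h, vertexKey_lt_of_min_lt hxy h]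
  · have := vertexKey_lt_of_min_eq hxy hc h
    split_ifs at this with hb
    · simp only [this, true_iff]
      exact Or.inr ⟨h, hb⟩
    · refine iff_of_false this.asymm ?_
      rintro (h' | ⟨-, h'⟩)
      · exact h'.ne h
      · exact hb h'
  · have := vertexKey_lt_of_min_lt (fun d hd => (hxy d hd).symm) h
    exact iff_of_false this.asymm (by omega)

theorem Nat.testBit_log_two {a : ℕ} (ha : a ≠ 0) : a.testBit (Nat.log 2 a) = true := by
  rw [Nat.testBit_eq_decide_div_mod_eq]
  have h1 := Nat.pow_log_le_self 2 ha
  have h2 := Nat.lt_pow_succ_log_self (b := 2) (by norm_num) a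
  have : a / 2 ^ Nat.log 2 a = 1 := by
    apply Nat.div_eq_of_lt_le
    · simpa using h1
    · rw [pow_succ] at h2; omega
  simp [this]

theorem Nat.eq_of_log_two_eq_of_testBit {a b : ℕ} (hlog : Nat.log 2 a = Nat.log 2 b)
    (h : ∀ p ≤ Nat.log 2 a, a.testBit p = b.testBit p) : a = b := by
  refine Nat.eq_of_testBit_eq fun p => ?_
  rcases le_or_gt p (Nat.log 2 a) with hp | hp
  · exact h p hp
  · rw [Nat.testBit_lt_two_pow (Nat.lt_pow_of_log_lt (by norm_num) hp),
      Nat.testBit_lt_two_pow (Nat.lt_pow_of_log_lt (by norm_num) (hlog ▸ hp))]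

theorem log_two_lt_of_fin {r : ℕ} (c : Fin (2 ^ r - 1)) : Nat.log 2 (c + 1) < r :=
  Nat.log_lt_of_lt_pow (by omega) (by have := c.2; omega)

end vertexKey

section pair

variable {r m : ℕ} {x y x' y' : Fin (2 ^ r - 1) → Fin m} {c d : Fin (2 ^ r - 1)}

theorem log_two_le_of_vertexKey_lt_iff (hxy : ∀ e < c, x e = y e) (hc : x c < y c)
    (hxy' : ∀ e < d, x' e = y' e) (hd : x' d < y' d)
    (h : ∀ i < r, ∀ j < r, vertexKey x i < vertexKey y j ↔ vertexKey x' i < vertexKey y' j) :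
    Nat.log 2 (d + 1) ≤ Nat.log 2 (c + 1) := by
  by_contra! hlt
  have := h _ (log_two_lt_of_fin d) _ (log_two_lt_of_fin c)
  rw [vertexKey_lt_iff hxy hc, vertexKey_lt_iff hxy' hd, min_eq_right hlt.le, min_self, min_self,
    min_eq_left hlt.le] at this
  have hb := Nat.testBit_log_two (Nat.succ_ne_zero c.val)
  have := this.1 (Or.inr ⟨rfl, hb⟩)
  omega

theorem eq_of_vertexKey_lt_iff (hxy : ∀ e < c, x e = y e) (hc : x c < y c)
    (hxy' : ∀ e < d, x' e = y' e) (hd : x' d < y' d)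
    (h : ∀ i < r, ∀ j < r, vertexKey x i < vertexKey y j ↔ vertexKey x' i < vertexKey y' j) :
    c = d := by
  have hlog : Nat.log 2 (c + 1) = Nat.log 2 (d + 1) :=
    le_antisymm (log_two_le_of_vertexKey_lt_iff hxy' hd hxy hc fun i hi j hj => (h i hi j hj).symm)
      (log_two_le_of_vertexKey_lt_iff hxy hc hxy' hd h)
  have : c.val + 1 = d.val + 1 := by
    refine Nat.eq_of_log_two_eq_of_testBit hlog fun p hp => ?_
    have hpr := hp.trans_lt (log_two_lt_of_fin c)
    have := h p hpr p hpr
    rw [vertexKey_lt_iff hxy hc, vertexKey_lt_iff hxy' hd, ← hlog, min_eq_left hp] at this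
    rw [Bool.eq_iff_iff]
    simpa using this
  exact Fin.ext (by omega)

theorem vertexKey_last_lt (hr : 0 < r) (hxy : ∀ e < c, x e = y e) (hc : x c < y c) :
    vertexKey x (r - 1) < vertexKey y (r - 1) := by
  have hle : Nat.log 2 (c + 1) ≤ r - 1 := by have := log_two_lt_of_fin c; omega
  rw [vertexKey_lt_iff hxy hc, min_eq_right hle]
  exact Or.inr ⟨rfl, Nat.testBit_log_two (Nat.succ_ne_zero _)⟩

/-- The relative order of the vertices of two edges, even up to exchanging the two edges,
determines the first coordinate at which their indices differ. -/
theorem eq_of_vertexKey_lt_iff_or (hr : 0 < r) (hxy : ∀ e < c, x e = y e) (hc : x c < y c)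
    (hxy' : ∀ e < d, x' e = y' e) (hd : x' d < y' d)
    (h : (∀ i < r, ∀ j < r, vertexKey x i < vertexKey y j ↔ vertexKey x' i < vertexKey y' j) ∨
      ∀ i < r, ∀ j < r, vertexKey x i < vertexKey y j ↔ vertexKey y' i < vertexKey x' j) :
    c = d := by
  rcases h with h | h
  · exact eq_of_vertexKey_lt_iff hxy hc hxy' hd h
  · have h1 := vertexKey_last_lt hr hxy hc
    have h2 := vertexKey_last_lt hr hxy' hd
    exact absurd ((h (r - 1) (by omega) (r - 1) (by omega)).1 h1) h2.asymm

theorem exists_first_ne (h : x ≠ y) : ∃ c, (∀ e < c, x e = y e) ∧ x c ≠ y c := by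
  obtain ⟨c, hc, hmin⟩ := WellFounded.has_min (wellFounded_lt (α := Fin (2 ^ r - 1)))
    {c | x c ≠ y c} (Function.ne_iff.1 h)
  exact ⟨c, fun e he => by_contra fun hne => hmin e hne he, hc⟩

theorem strictMono_vertexKey (x : Fin (2 ^ r - 1) → Fin m) :
    StrictMono fun i : Fin r => vertexKey x i := by
  intro i j hij
  have hij' : i.val < j.val := hij
  have hj := j.2
  obtain ⟨s, rfl⟩ : ∃ s, r = s + 1 := ⟨r - 1, by omega⟩
  have hs : 1 ≤ 2 ^ s := Nat.one_le_two_pow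
  have hlt : 2 ^ s - 1 < 2 ^ (s + 1) - 1 := by rw [pow_succ]; omega
  refine vertexKey_lt_of_min_lt (c := ⟨2 ^ s - 1, hlt⟩) (fun _ _ => rfl) ?_
  have : 2 ^ s - 1 + 1 = 2 ^ s := by omega
  simp only [this, Nat.log_pow (by norm_num : 1 < 2)]
  omega

theorem vertexKey_injective :
    Function.Injective fun p : (Fin (2 ^ r - 1) → Fin m) × Fin r => vertexKey p.1 p.2 := by
  rintro ⟨x, i⟩ ⟨y, j⟩ h
  have hxy : x = y := by
    by_contra hne
    obtain ⟨c, hxy, hc⟩ := exists_first_ne hne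
    simp only at h
    wlog hlt : x c < y c generalizing x y i j
    · exact this y j x i h.symm (Ne.symm hne) (fun e he => (hxy e he).symm) hc.symm
        (lt_of_le_of_ne (not_lt.1 hlt) hc.symm)
    rcases lt_trichotomy (min i.val (Nat.log 2 (c + 1))) (min j.val (Nat.log 2 (c + 1)))
      with h' | h' | h'
    · exact (vertexKey_lt_of_min_lt hxy h').ne h
    · have := vertexKey_lt_of_min_eq hxy hlt h'
      split_ifs at this
      · exact this.ne h
      · exact this.ne h.symm
    · exact (vertexKey_lt_of_min_lt (fun e he => (hxy e he).symm) h').ne h.symm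
  subst hxy
  exact Prod.ext rfl ((strictMono_vertexKey x).injective h)

end pair

theorem exists_matching_Lmax_le {r n m : ℕ} (hr : 0 < r) (hm : 0 < m)
    (hn : n ≤ m ^ (2 ^ r - 1)) :
    ∃ M : Finset (Finset ℕ), IsOrderedMatching r n M ∧ Lmax r M ≤ m := by
  classical
  obtain ⟨A, -, hA⟩ := Finset.exists_subset_card_eq
    (s := (Finset.univ : Finset (Fin (2 ^ r - 1) → Fin m))) (n := n) (by simpa using hn)
  let K := (A ×ˢ (Finset.univ : Finset (Fin r))).image fun p => vertexKey p.1 p.2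
  have hK : K.card = r * n := by
    rw [Finset.card_image_of_injective _ vertexKey_injective, Finset.card_product, hA]
    simp [mul_comm]
  obtain ⟨g, hg, hgK⟩ := exists_strictMonoOn_image_eq_Icc K
  let v : (Fin (2 ^ r - 1) → Fin m) → Fin r → ℕ := fun x i => g (vertexKey x i)
  have hmem : ∀ x ∈ A, ∀ i : Fin r, vertexKey x i ∈ (K : Set _) := fun x hx i =>
    Finset.mem_coe.2 (Finset.mem_image.2 ⟨(x, i), by simp [hx], rfl⟩)
  have hlt : ∀ x ∈ A, ∀ y ∈ A, ∀ i j : Fin r,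
      v x i < v y j ↔ vertexKey x i < vertexKey y j := fun x hx y hy i j =>
    hg.lt_iff_lt (hmem x hx i) (hmem y hy j)
  have hv : ∀ x ∈ A, StrictMono (v x) := fun x hx i j hij =>
    (hlt x hx x hx i j).2 (strictMono_vertexKey x hij)
  have hvinj : ∀ x ∈ A, ∀ y ∈ A, ∀ i j : Fin r, v x i = v y j → x = y := fun x hx y hy i j h =>
    congrArg Prod.fst (@vertexKey_injective r m (x, i) (y, j)
      (hg.injOn (hmem x hx i) (hmem y hy j) h))
  let E : (Fin (2 ^ r - 1) → Fin m) → Finset ℕ := fun x => Finset.univ.image (v x)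
  have hE : Set.InjOn E (A : Set _) := by
    intro x hx y hy h
    have : v x ⟨0, hr⟩ ∈ E y := h ▸ Finset.mem_image_of_mem _ (Finset.mem_univ _)
    obtain ⟨j, -, hj⟩ := Finset.mem_image.1 this
    exact hvinj x hx y hy _ _ hj.symm
  refine ⟨A.image E, ⟨?_, ?_, ?_, ?_⟩, ?_⟩
  · rw [Finset.card_image_of_injOn hE, hA]
  · intro e he
    obtain ⟨x, hx, rfl⟩ := Finset.mem_image.1 he
    rw [Finset.card_image_of_injective _ (hv x hx).injective]
    simp
  · intro e he f hf hef
    obtain ⟨x, hx, rfl⟩ := Finset.mem_image.1 he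
    obtain ⟨y, hy, rfl⟩ := Finset.mem_image.1 hf
    rw [Finset.disjoint_left]
    intro t ht ht'
    obtain ⟨i, -, rfl⟩ := Finset.mem_image.1 ht
    obtain ⟨j, -, hj⟩ := Finset.mem_image.1 ht'
    exact hef (congrArg E (hvinj x hx y hy _ _ hj.symm))
  · rw [← hK, ← hgK]
    ext t
    simp only [K, E, v, Finset.mem_biUnion, Finset.mem_image, Finset.mem_product, Finset.mem_univ,
      id_eq]
    constructor
    · rintro ⟨_, ⟨x, hx, rfl⟩, ht⟩
      obtain ⟨i, -, rfl⟩ := Finset.mem_image.1 ht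
      exact ⟨_, ⟨(x, i), ⟨hx, trivial⟩, rfl⟩, rfl⟩
    · rintro ⟨_, ⟨⟨x, i⟩, ⟨hx, -⟩, rfl⟩, rfl⟩
      exact ⟨_, ⟨x, hx, rfl⟩, Finset.mem_image_of_mem _ (Finset.mem_univ i)⟩
  · refine csSup_le' ?_
    rintro _ ⟨P, -, rfl⟩
    refine csSup_le' ?_
    rintro _ ⟨S, hS, hP, rfl⟩
    obtain ⟨B, hB, rfl⟩ := Finset.subset_image_iff.1 hS
    rw [Finset.card_image_of_injOn (hE.mono hB)]
    have hclique : ∀ x ∈ B, ∀ y ∈ B, x ≠ y → FormsPattern (E x) (E y) P := fun x hx y hy hne =>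
      hP _ (Finset.mem_image_of_mem _ hx) _ (Finset.mem_image_of_mem _ hy)
        fun h => hne (hE (hB hx) (hB hy) h)
    have hfirst : ∀ x ∈ B, ∀ y ∈ B, x ≠ y →
        ∃ x₁ ∈ B, ∃ y₁ ∈ B, x₁ ≠ y₁ ∧ ∃ c, (∀ e < c, x₁ e = y₁ e) ∧ x₁ c < y₁ c ∧ x c ≠ y c := by
      intro x hx y hy hne
      obtain ⟨c, hc, hc'⟩ := exists_first_ne hne
      rcases hc'.lt_or_gt with h | h
      · exact ⟨x, hx, y, hy, hne, c, hc, h, hc'⟩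
      · exact ⟨y, hy, x, hx, hne.symm, c, fun e he => (hc e he).symm, h, hc'⟩
    rcases le_or_gt B.card 1 with h1 | h1
    · omega
    obtain ⟨x₀, hx₀, y₀, hy₀, hne₀⟩ := Finset.one_lt_card.1 h1
    obtain ⟨x₁, hx₁, y₁, hy₁, hne₁, c, hc, hc', -⟩ := hfirst x₀ hx₀ y₀ hy₀ hne₀
    have hinj : Set.InjOn (fun x : Fin (2 ^ r - 1) → Fin m => x c) (B : Set _) := by
      intro x hx y hy hxy
      by_contra hne
      obtain ⟨x₂, hx₂, y₂, hy₂, hne₂, d, hd, hd', hd''⟩ := hfirst x hx y hy hne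
      have hcd : c = d := by
        refine eq_of_vertexKey_lt_iff_or hr hc hc' hd hd' ?_
        refine (FormsPattern.lt_iff_lt_or (hv x₁ (hB hx₁)) (hv y₁ (hB hy₁)) (hv x₂ (hB hx₂))
          (hv y₂ (hB hy₂)) (hclique x₁ hx₁ y₁ hy₁ hne₁) (hclique x₂ hx₂ y₂ hy₂ hne₂)).imp ?_ ?_
        · intro h i hi j hj
          have := h ⟨i, hi⟩ ⟨j, hj⟩
          rwa [hlt _ (hB hx₁) _ (hB hy₁), hlt _ (hB hx₂) _ (hB hy₂)] at this
        · intro h i hi j hj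
          have := h ⟨i, hi⟩ ⟨j, hj⟩
          rwa [hlt _ (hB hx₁) _ (hB hy₁), hlt _ (hB hy₂) _ (hB hx₂)] at this
      exact hd'' (hcd ▸ hxy)
    simpa using Finset.card_le_card_of_injOn (t := Finset.univ) _ (fun _ _ => Finset.mem_univ _)
      hinj

/-- **Upper bound in Theorem 1.1.** For every `r ≥ 2` and `n ≥ 1`, there is an
ordered `r`-matching `M` of size `n` with `L(M) ≤ ⌈n^(1/(2^r - 1))⌉`. -/
theorem ramsey_upper_bound (r n : ℕ) (hr : 2 ≤ r) (hn : 1 ≤ n) :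
    ∃ M : Finset (Finset ℕ), IsOrderedMatching r n M ∧
      Lmax r M ≤ ⌈(n : ℝ) ^ ((1 : ℝ) / ((2 : ℝ) ^ r - 1))⌉₊ := by
  have hn0 : (0 : ℝ) < n := by exact_mod_cast hn
  refine exists_matching_Lmax_le (by omega) (Nat.ceil_pos.2 (Real.rpow_pos_of_pos hn0 _)) ?_
  have h2 : 2 ^ r - 1 ≠ 0 := by
    have := Nat.pow_le_pow_right (n := 2) (by norm_num) hr
    omega
  have hcast : (2 : ℝ) ^ r - 1 = ((2 ^ r - 1 : ℕ) : ℝ) := by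
    rw [Nat.cast_sub Nat.one_le_two_pow]
    simp
  rw [hcast, one_div]
  have := pow_le_pow_left₀ (Real.rpow_nonneg hn0.le _)
    (Nat.le_ceil ((n : ℝ) ^ (((2 ^ r - 1 : ℕ) : ℝ)⁻¹))) (2 ^ r - 1)
  rw [Real.rpow_inv_natCast_pow hn0.le h2] at this
  exact_mod_cast this
end

section
/- For every positive integer n, the Ramsey parameter for ordered 3-matchings satisfies (1/2)·n^{1/7} ≤ L_3(n) ≤ ⌈n^{1/7}⌉. -/
open Finset

lemma FormsPattern.symm {e f : Finset ℕ} {P : Finset (Finset ℕ)} (h : FormsPattern e f P) :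
    FormsPattern f e P := by
  obtain ⟨φ, hφ, h⟩ := h
  exact ⟨φ, by rwa [union_comm], by rwa [pair_comm]⟩

lemma exists_strictMonoOn_six {a b c d e f : ℕ} (hab : a < b) (hbc : b < c) (hcd : c < d)
    (hde : d < e) (hef : e < f) :
    ∃ φ : ℕ → ℕ, StrictMonoOn φ (↑({a, b, c, d, e, f} : Finset ℕ) : Set ℕ) ∧
      φ a = 1 ∧ φ b = 2 ∧ φ c = 3 ∧ φ d = 4 ∧ φ e = 5 ∧ φ f = 6 := by
  refine ⟨fun v => if v ≤ a then 1 else if v ≤ b then 2 else if v ≤ c then 3 else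
    if v ≤ d then 4 else if v ≤ e then 5 else 6, ?_, ?_⟩
  · intro u hu v hv huv
    simp only [coe_insert, coe_singleton, Set.mem_insert_iff, Set.mem_singleton_iff] at hu hv
    dsimp only
    split_ifs <;> omega
  · refine ⟨?_, ?_, ?_, ?_, ?_, ?_⟩ <;> (dsimp only; split_ifs <;> omega)

lemma values_of_image_pattern {a b c d e f : ℕ} (hab : a < b) (hbc : b < c) (hcd : c < d)
    (hde : d < e) (hef : e < f) {s t : Finset ℕ} (hst : s ∪ t = {a, b, c, d, e, f})
    {φ : ℕ → ℕ} (hφ : StrictMonoOn φ (↑(s ∪ t) : Set ℕ))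
    (hP : IsPattern 3 {s.image φ, t.image φ}) :
    φ a = 1 ∧ φ b = 2 ∧ φ c = 3 ∧ φ d = 4 ∧ φ e = 5 ∧ φ f = 6 := by
  have hmem : ∀ v ∈ s ∪ t, 1 ≤ φ v ∧ φ v ≤ 6 := by
    intro v hv
    have hU := hP.2.2.2
    have : φ v ∈ Icc 1 (3 * 2) := by
      rw [← hU]
      simp only [mem_biUnion, mem_insert, mem_singleton, id, exists_eq_or_imp, exists_eq_left]
      rcases mem_union.1 hv with h | h
      · exact Or.inl (mem_image_of_mem φ h)
      · exact Or.inr (mem_image_of_mem φ h)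
    simpa using this
  rw [hst] at hφ hmem
  have h1 := hφ (by simp) (by simp) hab
  have h2 := hφ (by simp) (by simp) hbc
  have h3 := hφ (by simp) (by simp) hcd
  have h4 := hφ (by simp) (by simp) hde
  have h5 := hφ (by simp) (by simp) hef
  have h6 := hmem a (by simp)
  have h7 := hmem f (by simp)
  omega

section Mirsky

variable {α : Type*}

lemma exists_minimal_of_irrefl_trans (R : α → α → Prop) {S : Finset α} (hS : S.Nonempty)
    (irr : ∀ a ∈ S, ¬ R a a)
    (trans : ∀ a ∈ S, ∀ b ∈ S, ∀ c ∈ S, R a b → R b c → R a c) :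
    ∃ m ∈ S, ∀ a ∈ S, ¬ R a m := by
  induction hS using Finset.Nonempty.cons_induction with
  | singleton a => exact ⟨a, by simp, by simpa using irr⟩
  | cons a s ha hs ih =>
    simp only [mem_cons] at irr trans ⊢
    obtain ⟨m, hm, hmin⟩ := ih (fun b hb => irr b (.inr hb))
      (fun b hb c hc d hd => trans b (.inr hb) c (.inr hc) d (.inr hd))
    by_cases ham : R a m
    · refine ⟨a, .inl rfl, ?_⟩
      rintro b (rfl | hb) hba
      · exact irr b (.inl rfl) hba
      · exact hmin b hb (trans b (.inr hb) a (.inl rfl) m (.inr hm) hba ham)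
    · refine ⟨m, .inr hm, ?_⟩
      rintro b (rfl | hb)
      · exact ham
      · exact hmin b hb

/-- **Mirsky's theorem** in quantitative form: if every chain has at most `k` elements, then some
antichain contains at least a fraction `1 / k` of all elements. -/
lemma exists_antichain_of_chains_le (R : α → α → Prop) (k : ℕ) (S : Finset α)
    (irr : ∀ a ∈ S, ¬ R a a)
    (trans : ∀ a ∈ S, ∀ b ∈ S, ∀ c ∈ S, R a b → R b c → R a c)
    (hk : ∀ C ⊆ S, (∀ a ∈ C, ∀ b ∈ C, a ≠ b → R a b ∨ R b a) → C.card ≤ k) :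
    ∃ A ⊆ S, S.card ≤ k * A.card ∧ ∀ a ∈ A, ∀ b ∈ A, ¬ R a b := by
  classical
  induction k generalizing S with
  | zero =>
    refine ⟨∅, by simp, ?_, by simp⟩
    rcases S.eq_empty_or_nonempty with rfl | ⟨a, ha⟩
    · simp
    · have := hk {a} (by simpa using ha) (by simp)
      simp at this
  | succ k ih =>
    set A := S.filter (fun m => ∀ a ∈ S, ¬ R a m) with hA
    have hAS : A ⊆ S := filter_subset _ _
    have hsub : S \ A ⊆ S := sdiff_subset
    obtain ⟨B, hBS, hB, hBanti⟩ := ih (S \ A) (fun a ha => irr a (hsub ha))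
      (fun a ha b hb c hc => trans a (hsub ha) b (hsub hb) c (hsub hc)) (by
        intro C hC hchain
        rcases C.eq_empty_or_nonempty with rfl | hne
        · simp
        have hCS : C ⊆ S := hC.trans hsub
        obtain ⟨m, hm, hmin⟩ := exists_minimal_of_irrefl_trans R hne
          (fun a ha => irr a (hCS ha))
          (fun a ha b hb c hc => trans a (hCS ha) b (hCS hb) c (hCS hc))
        have hmA := hC hm
        simp only [hA, mem_sdiff, mem_filter, not_and, not_forall, not_not] at hmA
        obtain ⟨l, hl, hlm⟩ := hmA.2 hmA.1
        have hall : ∀ c ∈ C, R l c := by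
          intro c hc
          by_cases hcm : c = m
          · exact hcm ▸ hlm
          · exact trans l hl m hmA.1 c (hCS hc) hlm
              ((hchain c hc m hm hcm).resolve_left (hmin c hc))
        have hlC : l ∉ C := fun h => irr l hl (hall l h)
        have := hk (insert l C) (insert_subset hl hCS) (by
          intro a ha b hb hab
          rcases mem_insert.1 ha with rfl | ha' <;> rcases mem_insert.1 hb with rfl | hb'
          · exact absurd rfl hab
          · exact .inl (hall b hb')
          · exact .inr (hall a ha')
          · exact hchain a ha' b hb' hab)
        rw [card_insert_of_notMem hlC] at this
        omega)
    have hcard : (S \ A).card + A.card = S.card := card_sdiff_add_card_eq_card hAS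
    rcases le_total A.card B.card with h | h
    · exact ⟨B, hBS.trans hsub, by nlinarith, hBanti⟩
    · refine ⟨A, hAS, by nlinarith, fun a ha b hb => ?_⟩
      exact (mem_filter.1 hb).2 a (hAS ha)

end Mirsky

lemma cliqueSize_le_card (P M : Finset (Finset ℕ)) : cliqueSize P M ≤ M.card :=
  csSup_le' (by rintro k ⟨S, hS, -, rfl⟩; exact card_le_card hS)

lemma card_le_Lmax {r : ℕ} {P S M : Finset (Finset ℕ)} (hP : IsPattern r P) (hS : S ⊆ M)
    (hc : IsPatternClique P S) : S.card ≤ Lmax r M :=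
  calc S.card ≤ cliqueSize P M :=
        le_csSup ⟨M.card, by rintro k ⟨T, hT, -, rfl⟩; exact card_le_card hT⟩ ⟨S, hS, hc, rfl⟩
    _ ≤ Lmax r M :=
        le_csSup ⟨M.card, by rintro k ⟨Q, -, rfl⟩; exact cliqueSize_le_card Q M⟩ ⟨P, hP, rfl⟩

lemma Lmax_le {r k : ℕ} {M : Finset (Finset ℕ)}
    (h : ∀ P, IsPattern r P → ∀ S ⊆ M, IsPatternClique P S → S.card ≤ k) : Lmax r M ≤ k := by
  refine csSup_le' ?_
  rintro _ ⟨P, hP, rfl⟩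
  refine csSup_le' ?_
  rintro _ ⟨S, hS, hc, rfl⟩
  exact h P hP S hS hc

lemma exists_antichain_of_formsPattern {r : ℕ} {P M S : Finset (Finset ℕ)} (hP : IsPattern r P)
    (hSM : S ⊆ M) (R : Finset ℕ → Finset ℕ → Prop) (irr : ∀ a ∈ S, ¬ R a a)
    (trans : ∀ a ∈ S, ∀ b ∈ S, ∀ c ∈ S, R a b → R b c → R a c)
    (hR : ∀ a ∈ S, ∀ b ∈ S, R a b → FormsPattern a b P) :
    ∃ A ⊆ S, S.card ≤ Lmax r M * A.card ∧ ∀ a ∈ A, ∀ b ∈ A, ¬ R a b := by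
  refine exists_antichain_of_chains_le R _ S irr trans fun C hC hchain => ?_
  refine card_le_Lmax hP (hC.trans hSM) fun a ha b hb hab => ?_
  rcases hchain a ha b hb hab with h | h
  · exact hR a (hC ha) b (hC hb) h
  · exact (hR b (hC hb) a (hC ha) h).symm

lemma exists_sorted_triple {e : Finset ℕ} (he : e.card = 3) :
    ∃ x y z : ℕ, x < y ∧ y < z ∧ e = {x, y, z} := by
  refine ⟨e.orderEmbOfFin he 0, e.orderEmbOfFin he 1, e.orderEmbOfFin he 2,
    (e.orderEmbOfFin he).strictMono (by decide), (e.orderEmbOfFin he).strictMono (by decide), ?_⟩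
  have h := e.image_orderEmbOfFin_univ he
  ext v
  rw [← Finset.ext_iff.1 h v]
  simp only [mem_image, mem_univ, true_and, Fin.exists_fin_succ, mem_insert, mem_singleton]
  simp [eq_comm]

/-- Coordinate functions listing the elements of each edge of `M` in increasing order. -/
structure IsCoords (M : Finset (Finset ℕ)) (x y z : Finset ℕ → ℕ) : Prop where
  lt_xy : ∀ e ∈ M, x e < y e
  lt_yz : ∀ e ∈ M, y e < z e
  eq : ∀ e ∈ M, e = {x e, y e, z e}
  disj : ∀ e ∈ M, ∀ f ∈ M, e ≠ f → Disjoint e f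

lemma IsOrderedMatching.exists_isCoords {n : ℕ} {M : Finset (Finset ℕ)}
    (h : IsOrderedMatching 3 n M) : ∃ x y z, IsCoords M x y z := by
  have : ∀ e : Finset ℕ, ∃ x y z : ℕ, e ∈ M → x < y ∧ y < z ∧ e = {x, y, z} := by
    intro e
    by_cases he : e ∈ M
    · obtain ⟨x, y, z, h⟩ := exists_sorted_triple (h.2.1 e he)
      exact ⟨x, y, z, fun _ => h⟩
    · exact ⟨0, 0, 0, fun h => absurd h he⟩
  choose x y z H using this
  exact ⟨x, y, z, fun e he => (H e he).1, fun e he => (H e he).2.1, fun e he => (H e he).2.2,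
    h.2.2.1⟩

namespace IsCoords

variable {M S : Finset (Finset ℕ)} {x y z : Finset ℕ → ℕ}

lemma mono (h : IsCoords M x y z) (hS : S ⊆ M) : IsCoords S x y z :=
  ⟨fun e he => h.lt_xy e (hS he), fun e he => h.lt_yz e (hS he), fun e he => h.eq e (hS he),
    fun e he f hf => h.disj e (hS he) f (hS hf)⟩

lemma ne (h : IsCoords M x y z) {e f : Finset ℕ} (he : e ∈ M) (hf : f ∈ M) (hef : e ≠ f) :
    x e ≠ x f ∧ x e ≠ y f ∧ x e ≠ z f ∧ y e ≠ x f ∧ y e ≠ y f ∧ y e ≠ z f ∧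
      z e ≠ x f ∧ z e ≠ y f ∧ z e ≠ z f := by
  have hd := h.disj e he f hf hef
  rw [h.eq e he, h.eq f hf] at hd
  simp only [disjoint_insert_left, disjoint_singleton_left, mem_insert, mem_singleton,
    not_or] at hd
  tauto

lemma formsPattern (h : IsCoords M x y z) {e f : Finset ℕ} (he : e ∈ M) (hf : f ∈ M)
    {a b c d i j : ℕ} (hab : a < b) (hbc : b < c) (hcd : c < d) (hdi : d < i) (hij : i < j)
    {P : Finset (Finset ℕ)}
    (hsub : ({x e, y e, z e} ∪ {x f, y f, z f} : Finset ℕ) ⊆ {a, b, c, d, i, j})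
    (hP : ∀ φ : ℕ → ℕ, φ a = 1 → φ b = 2 → φ c = 3 → φ d = 4 → φ i = 5 → φ j = 6 →
      ({{φ (x e), φ (y e), φ (z e)}, {φ (x f), φ (y f), φ (z f)}} : Finset (Finset ℕ)) = P) :
    FormsPattern e f P := by
  obtain ⟨φ, hφ, h1, h2, h3, h4, h5, h6⟩ := exists_strictMonoOn_six hab hbc hcd hdi hij
  rw [h.eq e he, h.eq f hf]
  refine ⟨φ, hφ.mono (by exact_mod_cast hsub), ?_⟩
  rw [← hP φ h1 h2 h3 h4 h5 h6]
  simp only [image_insert, image_singleton]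

/-- A matching whose coordinates lie in three consecutive intervals has few edges. -/
lemma card_le_of_tripartite (h : IsCoords M x y z) (hS : S ⊆ M)
    (hxy : ∀ e ∈ S, ∀ f ∈ S, x e < y f) (hyz : ∀ e ∈ S, ∀ f ∈ S, y e < z f) :
    S.card ≤ Lmax 3 M ^ 4 := by
  obtain ⟨A, hA, cA, nA⟩ := exists_antichain_of_formsPattern (r := 3) (M := M) (S := S)
    (P := {{1, 3, 5}, {2, 4, 6}}) (by unfold IsPattern IsOrderedMatching; decide) hS
    (fun e f => x e < x f ∧ y e < y f ∧ z e < z f) (by simp) (by intros; omega) (by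
      intro e he f hf hef
      refine h.formsPattern (hS he) (hS hf) hef.1 (hxy f hf e he) hef.2.1 (hyz f hf e he) hef.2.2
        (by intro v; simp; tauto) ?_
      intro φ h1 h2 h3 h4 h5 h6; rw [h1, h2, h3, h4, h5, h6])
  obtain ⟨B, hB, cB, nB⟩ := exists_antichain_of_formsPattern (r := 3) (M := M) (S := A)
    (P := {{1, 3, 6}, {2, 4, 5}}) (by unfold IsPattern IsOrderedMatching; decide) (hA.trans hS)
    (fun e f => x e < x f ∧ y e < y f ∧ z f < z e) (by simp) (by intros; omega) (by
      intro e he f hf hef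
      have he := hA he
      have hf := hA hf
      refine h.formsPattern (hS he) (hS hf) hef.1 (hxy f hf e he) hef.2.1 (hyz f hf f hf) hef.2.2
        (by intro v; simp; tauto) ?_
      intro φ h1 h2 h3 h4 h5 h6; rw [h1, h2, h3, h4, h5, h6])
  obtain ⟨C, hC, cC, nC⟩ := exists_antichain_of_formsPattern (r := 3) (M := M) (S := B)
    (P := {{1, 4, 5}, {2, 3, 6}}) (by unfold IsPattern IsOrderedMatching; decide)
    (hB.trans (hA.trans hS))
    (fun e f => x e < x f ∧ y f < y e ∧ z e < z f) (by simp) (by intros; omega) (by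
      intro e he f hf hef
      have he := hA (hB he)
      have hf := hA (hB hf)
      refine h.formsPattern (hS he) (hS hf) hef.1 (hxy f hf f hf) hef.2.1 (hyz e he e he) hef.2.2
        (by intro v; simp; tauto) ?_
      intro φ h1 h2 h3 h4 h5 h6; rw [h1, h2, h3, h4, h5, h6])
  obtain ⟨D, hD, cD, nD⟩ := exists_antichain_of_formsPattern (r := 3) (M := M) (S := C)
    (P := {{1, 4, 6}, {2, 3, 5}}) (by unfold IsPattern IsOrderedMatching; decide)
    (hC.trans (hB.trans (hA.trans hS)))
    (fun e f => x e < x f ∧ y f < y e ∧ z f < z e) (by simp) (by intros; omega) (by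
      intro e he f hf hef
      have he := hA (hB (hC he))
      have hf := hA (hB (hC hf))
      refine h.formsPattern (hS he) (hS hf) hef.1 (hxy f hf f hf) hef.2.1 (hyz e he f hf) hef.2.2
        (by intro v; simp; tauto) ?_
      intro φ h1 h2 h3 h4 h5 h6; rw [h1, h2, h3, h4, h5, h6])
  have hD1 : D.card ≤ 1 := by
    refine card_le_one.2 fun e he f hf => ?_
    by_contra hne
    have heC := hD he
    have hfC := hD hf
    have hn := h.ne (hS (hA (hB (hC heC)))) (hS (hA (hB (hC hfC)))) hne
    obtain ⟨hx, -, -, -, hy, -, -, -, hz⟩ := hn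
    rcases lt_or_gt_of_ne hx with hx | hx <;> rcases lt_or_gt_of_ne hy with hy | hy <;>
      rcases lt_or_gt_of_ne hz with hz | hz
    · exact nA e (hB (hC heC)) f (hB (hC hfC)) ⟨hx, hy, hz⟩
    · exact nB e (hC heC) f (hC hfC) ⟨hx, hy, hz⟩
    · exact nC e heC f hfC ⟨hx, hy, hz⟩
    · exact nD e he f hf ⟨hx, hy, hz⟩
    · exact nD f hf e he ⟨hx, hy, hz⟩
    · exact nC f hfC e heC ⟨hx, hy, hz⟩
    · exact nB f (hC hfC) e (hC heC) ⟨hx, hy, hz⟩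
    · exact nA f (hB (hC hfC)) e (hB (hC heC)) ⟨hx, hy, hz⟩
  calc S.card ≤ Lmax 3 M * (Lmax 3 M * (Lmax 3 M * (Lmax 3 M * 1))) := by
        refine cA.trans (Nat.mul_le_mul_left _ (cB.trans (Nat.mul_le_mul_left _
          (cC.trans (Nat.mul_le_mul_left _ (cD.trans (Nat.mul_le_mul_left _ hD1)))))))
    _ = Lmax 3 M ^ 4 := by ring

/-- A matching whose first coordinates precede all the others. -/
lemma card_le_of_left (h : IsCoords M x y z) (hS : S ⊆ M)
    (hxy : ∀ e ∈ S, ∀ f ∈ S, x e < y f) : S.card ≤ Lmax 3 M ^ 6 := by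
  obtain ⟨A, hA, cA, nA⟩ := exists_antichain_of_formsPattern (r := 3) (M := M) (S := S)
    (P := {{1, 3, 4}, {2, 5, 6}}) (by unfold IsPattern IsOrderedMatching; decide) hS
    (fun e f => x e < x f ∧ z e < y f) (by simp)
    (by intro e _ f hf g _ h1 h2; have := h.lt_yz f (hS hf); omega) (by
      intro e he f hf hef
      refine h.formsPattern (hS he) (hS hf) hef.1 (hxy f hf e he) (h.lt_yz e (hS he)) hef.2
        (h.lt_yz f (hS hf)) (by intro v; simp; tauto) ?_
      intro φ h1 h2 h3 h4 h5 h6; rw [h1, h2, h3, h4, h5, h6])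
  obtain ⟨B, hB, cB, nB⟩ := exists_antichain_of_formsPattern (r := 3) (M := M) (S := A)
    (P := {{1, 5, 6}, {2, 3, 4}}) (by unfold IsPattern IsOrderedMatching; decide) (hA.trans hS)
    (fun e f => x e < x f ∧ z f < y e) (by simp)
    (by intro e _ f hf g _ h1 h2; have := h.lt_yz f (hS (hA hf)); omega) (by
      intro e he f hf hef
      have he := hA he
      have hf := hA hf
      refine h.formsPattern (hS he) (hS hf) hef.1 (hxy f hf f hf) (h.lt_yz f (hS hf)) hef.2
        (h.lt_yz e (hS he)) (by intro v; simp; tauto) ?_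
      intro φ h1 h2 h3 h4 h5 h6; rw [h1, h2, h3, h4, h5, h6])
  have key := h.card_le_of_tripartite (S := B) (hB.trans (hA.trans hS))
    (fun e he f hf => hxy e (hA (hB he)) f (hA (hB hf))) (by
      intro e he f hf
      by_cases hne : e = f
      · exact hne ▸ h.lt_yz e (hS (hA (hB he)))
      have hn := h.ne (hS (hA (hB he))) (hS (hA (hB hf))) hne
      have a1 := nA e (hB he) f (hB hf)
      have a2 := nA f (hB hf) e (hB he)
      have b1 := nB e he f hf
      have b2 := nB f hf e he
      omega)
  calc S.card ≤ Lmax 3 M * (Lmax 3 M * Lmax 3 M ^ 4) :=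
        cA.trans (Nat.mul_le_mul_left _ (cB.trans (Nat.mul_le_mul_left _ key)))
    _ = Lmax 3 M ^ 6 := by ring

/-- A matching whose last coordinates follow all the others. -/
lemma card_le_of_right (h : IsCoords M x y z) (hS : S ⊆ M)
    (hyz : ∀ e ∈ S, ∀ f ∈ S, y e < z f) : S.card ≤ Lmax 3 M ^ 6 := by
  obtain ⟨A, hA, cA, nA⟩ := exists_antichain_of_formsPattern (r := 3) (M := M) (S := S)
    (P := {{1, 2, 5}, {3, 4, 6}}) (by unfold IsPattern IsOrderedMatching; decide) hS
    (fun e f => y e < x f ∧ z e < z f) (by simp)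
    (by intro e _ f hf g _ h1 h2; have := h.lt_xy f (hS hf); omega) (by
      intro e he f hf hef
      refine h.formsPattern (hS he) (hS hf) (h.lt_xy e (hS he)) hef.1 (h.lt_xy f (hS hf))
        (hyz f hf e he) hef.2 (by intro v; simp; tauto) ?_
      intro φ h1 h2 h3 h4 h5 h6; rw [h1, h2, h3, h4, h5, h6])
  obtain ⟨B, hB, cB, nB⟩ := exists_antichain_of_formsPattern (r := 3) (M := M) (S := A)
    (P := {{1, 2, 6}, {3, 4, 5}}) (by unfold IsPattern IsOrderedMatching; decide) (hA.trans hS)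
    (fun e f => y e < x f ∧ z f < z e) (by simp)
    (by intro e _ f hf g _ h1 h2; have := h.lt_xy f (hS (hA hf)); omega) (by
      intro e he f hf hef
      have he := hA he
      have hf := hA hf
      refine h.formsPattern (hS he) (hS hf) (h.lt_xy e (hS he)) hef.1 (h.lt_xy f (hS hf))
        (hyz f hf f hf) hef.2 (by intro v; simp; tauto) ?_
      intro φ h1 h2 h3 h4 h5 h6; rw [h1, h2, h3, h4, h5, h6])
  have key := h.card_le_of_tripartite (S := B) (hB.trans (hA.trans hS)) (by
      intro e he f hf
      by_cases hne : e = f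
      · exact hne ▸ h.lt_xy e (hS (hA (hB he)))
      have hn := h.ne (hS (hA (hB he))) (hS (hA (hB hf))) hne
      have a2 := nA f (hB hf) e (hB he)
      have b2 := nB f hf e he
      omega) (fun e he f hf => hyz e (hA (hB he)) f (hA (hB hf)))
  calc S.card ≤ Lmax 3 M * (Lmax 3 M * Lmax 3 M ^ 4) :=
        cA.trans (Nat.mul_le_mul_left _ (cB.trans (Nat.mul_le_mul_left _ key)))
    _ = Lmax 3 M ^ 6 := by ring

lemma card_le (h : IsCoords M x y z) : M.card ≤ 2 * Lmax 3 M ^ 7 := by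
  obtain ⟨A, hA, cA, nA⟩ := exists_antichain_of_formsPattern (r := 3) (M := M) (S := M)
    (P := {{1, 2, 3}, {4, 5, 6}}) (by unfold IsPattern IsOrderedMatching; decide) subset_rfl
    (fun e f => z e < x f)
    (by intro e he; have := h.lt_xy e he; have := h.lt_yz e he; omega)
    (by
      intro e _ f hf g _ h1 h2
      have := h.lt_xy f hf
      have := h.lt_yz f hf
      omega) (by
      intro e he f hf hef
      refine h.formsPattern he hf (h.lt_xy e he) (h.lt_yz e he) hef (h.lt_xy f hf)
        (h.lt_yz f hf) (by intro v; simp; tauto) ?_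
      intro φ h1 h2 h3 h4 h5 h6; rw [h1, h2, h3, h4, h5, h6])
  set t := A.sup x with ht
  have hxt : ∀ e ∈ A, x e ≤ t := fun e he => le_sup (f := x) he
  have htz : ∀ e ∈ A, t < z e := by
    intro e he
    have hlt : x e < z e := (h.lt_xy e (hA he)).trans (h.lt_yz e (hA he))
    refine (Finset.sup_lt_iff (Nat.zero_le _ |>.trans_lt hlt)).2 fun f hf => ?_
    by_cases hne : e = f
    · exact hne ▸ hlt
    have hn := h.ne (hA he) (hA hf) hne
    have := nA e he f hf
    omega
  have h1 := h.card_le_of_right (S := A.filter (fun e => y e ≤ t)) ((filter_subset _ _).trans hA)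
    (fun e he f hf => (mem_filter.1 he).2.trans_lt (htz f (mem_filter.1 hf).1))
  have h2 := h.card_le_of_left (S := A.filter (fun e => ¬ y e ≤ t)) ((filter_subset _ _).trans hA)
    (fun e he f hf => (hxt e (mem_filter.1 he).1).trans_lt (not_le.1 (mem_filter.1 hf).2))
  have h3 := card_filter_add_card_filter_not (s := A) (fun e => y e ≤ t)
  calc M.card ≤ Lmax 3 M * A.card := cA
    _ ≤ Lmax 3 M * (2 * Lmax 3 M ^ 6) := Nat.mul_le_mul_left _ (by omega)
    _ = 2 * Lmax 3 M ^ 7 := by ring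

end IsCoords

/-! ### The extremal matching -/

/-- The three vertices of the edge indexed by `d`, as words compared lexicographically. -/
def vertexWord (k : ℕ) (d : Fin 7 → Fin k) : Fin 3 → List ℕ :=
  ![[d 0, 0, d 1, d 2, d 3, d 4, d 5, d 6],
    [d 0, 1, d 1, k - d 2, 0, d 3, d 4, k - d 5, k - d 6],
    [d 0, 1, d 1, k - d 2, 1, d 3, k - d 4, d 5, k - d 6]]

/-- The pattern formed by two edges whose indices first differ in the given coordinate. -/
def firstDiffPattern : Fin 7 → Finset (Finset ℕ) :=
  ![{{1, 2, 3}, {4, 5, 6}}, {{1, 3, 4}, {2, 5, 6}}, {{1, 5, 6}, {2, 3, 4}},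
    {{1, 3, 5}, {2, 4, 6}}, {{1, 3, 6}, {2, 4, 5}}, {{1, 4, 5}, {2, 3, 6}},
    {{1, 4, 6}, {2, 3, 5}}]

lemma firstDiffPattern_injective : Function.Injective firstDiffPattern := by
  intro i j
  revert i j
  decide

lemma exists_first_diff {k : ℕ} {d d' : Fin 7 → Fin k} (h : d ≠ d') :
    ∃ i, (∀ j < i, d j = d' j) ∧ d i ≠ d' i := by
  obtain ⟨i, hi⟩ := Function.ne_iff.1 h
  have hne : (univ.filter fun i => d i ≠ d' i).Nonempty := ⟨i, by simpa using hi⟩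
  refine ⟨_, fun j hj => ?_, (mem_filter.1 (min'_mem _ hne)).2⟩
  by_contra hc
  exact absurd (min'_le _ j (by simpa using hc)) (not_le.2 hj)

lemma vertexWord_injective (k : ℕ) :
    Function.Injective fun p : (Fin 7 → Fin k) × Fin 3 => vertexWord k p.1 p.2 := by
  rintro ⟨d, i⟩ ⟨d', i'⟩ h
  have hd : ∀ j, (d j : ℕ) < k := fun j => (d j).2
  have hd' : ∀ j, (d' j : ℕ) < k := fun j => (d' j).2
  have := hd 2; have := hd 4; have := hd 5; have := hd 6
  have := hd' 2; have := hd' 4; have := hd' 5; have := hd' 6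
  have key : ((∀ j : Fin 7, (d j : ℕ) = d' j) ∧ i = i') := by
    fin_cases i <;> fin_cases i' <;> simp [vertexWord, Fin.forall_fin_succ] at h ⊢ <;> omega
  exact Prod.ext (funext fun j => Fin.ext (key.1 j)) key.2

lemma vertexWord_lt (k : ℕ) (d : Fin 7 → Fin k) :
    vertexWord k d 0 < vertexWord k d 1 ∧ vertexWord k d 1 < vertexWord k d 2 := by
  simp [vertexWord, List.cons_lt_cons_iff]

/-- If the indices `d`, `d'` first differ at `i`, where `d i < d' i`, then the corresponding edges
can form only the pattern `firstDiffPattern i`. -/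
lemma eq_firstDiffPattern {k : ℕ} {ρ : List ℕ → ℕ} {U : Set (List ℕ)} (hρ : StrictMonoOn ρ U)
    {d d' : Fin 7 → Fin k} (hdU : ∀ j, vertexWord k d j ∈ U) (hdU' : ∀ j, vertexWord k d' j ∈ U)
    {i : Fin 7} (hlt : ∀ j < i, d j = d' j) (hi : d i < d' i) {P : Finset (Finset ℕ)}
    (hP : IsPattern 3 P)
    (hF : FormsPattern (univ.image fun j => ρ (vertexWord k d j))
      (univ.image fun j => ρ (vertexWord k d' j)) P) : P = firstDiffPattern i := by
  obtain ⟨φ, hφ, rfl⟩ := hF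
  have hdef : ∀ d : Fin 7 → Fin k, (univ.image fun j => ρ (vertexWord k d j)) =
      {ρ (vertexWord k d 0), ρ (vertexWord k d 1), ρ (vertexWord k d 2)} := by
    intro d
    ext v
    simp [Fin.exists_fin_succ, eq_comm]
  rw [hdef, hdef] at hφ hP ⊢
  have r1 : ∀ a b, vertexWord k d a < vertexWord k d' b →
    ρ (vertexWord k d a) < ρ (vertexWord k d' b) := fun _ _ h => hρ (hdU _) (hdU' _) h
  have r2 : ∀ a b, vertexWord k d' a < vertexWord k d b →
    ρ (vertexWord k d' a) < ρ (vertexWord k d b) := fun _ _ h => hρ (hdU' _) (hdU _) h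
  have A1 := hρ (hdU _) (hdU _) (vertexWord_lt k d).1
  have A2 := hρ (hdU _) (hdU _) (vertexWord_lt k d).2
  have B1 := hρ (hdU' _) (hdU' _) (vertexWord_lt k d').1
  have B2 := hρ (hdU' _) (hdU' _) (vertexWord_lt k d').2
  have hk : ∀ j, (d' j : ℕ) < k := fun j => (d' j).2
  have k2 := hk 2
  have k4 := hk 4
  have k5 := hk 5
  have k6 := hk 6
  have hi' : (d i : ℕ) < d' i := hi
  have hlt' : ∀ j < i, (d j : ℕ) = d' j := fun j hj => congrArg _ (hlt j hj)
  clear hlt hi hdef hk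
  fin_cases i
  · have hd : (d 0 : ℕ) < d' 0 := hi'
    have h2 := r1 2 0 (by simp [vertexWord, List.cons_lt_cons_iff]; omega)
    obtain ⟨v1, v2, v3, v4, v5, v6⟩ := values_of_image_pattern A1 A2 h2 B1 B2
      (by grind) hφ hP
    simp only [image_insert, image_singleton, v1, v2, v3, v4, v5, v6]
    rfl
  · have hd : (d 1 : ℕ) < d' 1 := hi'
    have e0 := hlt' 0 (by decide)
    have h0 := r1 0 0 (by simp [vertexWord, List.cons_lt_cons_iff, e0]; omega)
    have h1 := r2 0 1 (by simp [vertexWord, List.cons_lt_cons_iff, e0])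
    have h3 := r1 2 1 (by simp [vertexWord, List.cons_lt_cons_iff, e0]; omega)
    obtain ⟨v1, v2, v3, v4, v5, v6⟩ := values_of_image_pattern h0 h1 A2 h3 B2
      (by grind) hφ hP
    simp only [image_insert, image_singleton, v1, v2, v3, v4, v5, v6]
    rfl
  · have hd : (d 2 : ℕ) < d' 2 := hi'
    have e0 := hlt' 0 (by decide)
    have e1 := hlt' 1 (by decide)
    have h0 := r1 0 0 (by simp [vertexWord, List.cons_lt_cons_iff, e0, e1]; omega)
    have h3 := r2 2 1 (by simp [vertexWord, List.cons_lt_cons_iff, e0, e1]; omega)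
    obtain ⟨v1, v2, v3, v4, v5, v6⟩ := values_of_image_pattern h0 B1 B2 h3 A2
      (by grind) hφ hP
    simp only [image_insert, image_singleton, v1, v2, v3, v4, v5, v6]
    rfl
  · have hd : (d 3 : ℕ) < d' 3 := hi'
    have e0 := hlt' 0 (by decide)
    have e1 := hlt' 1 (by decide)
    have e2 := hlt' 2 (by decide)
    have h0 := r1 0 0 (by simp [vertexWord, List.cons_lt_cons_iff, e0, e1, e2]; omega)
    have h1 := r2 0 1 (by simp [vertexWord, List.cons_lt_cons_iff, e0, e1, e2])
    have h2 := r1 1 1 (by simp [vertexWord, List.cons_lt_cons_iff, e0, e1, e2]; omega)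
    have h3 := r2 1 2 (by simp [vertexWord, List.cons_lt_cons_iff, e0, e1, e2])
    have h4 := r1 2 2 (by simp [vertexWord, List.cons_lt_cons_iff, e0, e1, e2]; omega)
    obtain ⟨v1, v2, v3, v4, v5, v6⟩ := values_of_image_pattern h0 h1 h2 h3 h4
      (by grind) hφ hP
    simp only [image_insert, image_singleton, v1, v2, v3, v4, v5, v6]
    rfl
  · have hd : (d 4 : ℕ) < d' 4 := hi'
    have e0 := hlt' 0 (by decide)
    have e1 := hlt' 1 (by decide)
    have e2 := hlt' 2 (by decide)
    have e3 := hlt' 3 (by decide)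
    have h0 := r1 0 0 (by simp [vertexWord, List.cons_lt_cons_iff, e0, e1, e2, e3]; omega)
    have h1 := r2 0 1 (by simp [vertexWord, List.cons_lt_cons_iff, e0, e1, e2, e3])
    have h2 := r1 1 1 (by simp [vertexWord, List.cons_lt_cons_iff, e0, e1, e2, e3]; omega)
    have h4 := r2 2 2 (by simp [vertexWord, List.cons_lt_cons_iff, e0, e1, e2, e3]; omega)
    obtain ⟨v1, v2, v3, v4, v5, v6⟩ := values_of_image_pattern h0 h1 h2 B2 h4
      (by grind) hφ hP
    simp only [image_insert, image_singleton, v1, v2, v3, v4, v5, v6]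
    rfl
  · have hd : (d 5 : ℕ) < d' 5 := hi'
    have e0 := hlt' 0 (by decide)
    have e1 := hlt' 1 (by decide)
    have e2 := hlt' 2 (by decide)
    have e3 := hlt' 3 (by decide)
    have e4 := hlt' 4 (by decide)
    have h0 := r1 0 0 (by simp [vertexWord, List.cons_lt_cons_iff, e0, e1, e2, e3, e4]; omega)
    have h2 := r2 1 1 (by simp [vertexWord, List.cons_lt_cons_iff, e0, e1, e2, e3, e4]; omega)
    have h4 := r1 2 2 (by simp [vertexWord, List.cons_lt_cons_iff, e0, e1, e2, e3, e4]; omega)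
    obtain ⟨v1, v2, v3, v4, v5, v6⟩ := values_of_image_pattern h0 B1 h2 A2 h4
      (by grind) hφ hP
    simp only [image_insert, image_singleton, v1, v2, v3, v4, v5, v6]
    rfl
  · have hd : (d 6 : ℕ) < d' 6 := hi'
    have e0 := hlt' 0 (by decide)
    have e1 := hlt' 1 (by decide)
    have e2 := hlt' 2 (by decide)
    have e3 := hlt' 3 (by decide)
    have e4 := hlt' 4 (by decide)
    have e5 := hlt' 5 (by decide)
    have h0 := r1 0 0 (by simp [vertexWord, List.cons_lt_cons_iff, e0, e1, e2, e3, e4, e5]; omega)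
    have h2 := r2 1 1 (by simp [vertexWord, List.cons_lt_cons_iff, e0, e1, e2, e3, e4, e5]; omega)
    have h3 := r1 1 2 (by simp [vertexWord, List.cons_lt_cons_iff, e0, e1, e2, e3, e4, e5])
    have h4 := r2 2 2 (by simp [vertexWord, List.cons_lt_cons_iff, e0, e1, e2, e3, e4, e5]; omega)
    obtain ⟨v1, v2, v3, v4, v5, v6⟩ := values_of_image_pattern h0 B1 h2 h3 h4
      (by grind) hφ hP
    simp only [image_insert, image_singleton, v1, v2, v3, v4, v5, v6]
    rfl

lemma FormsPattern.exists_ne_and_eq_firstDiffPattern {k : ℕ} {ρ : List ℕ → ℕ} {U : Set (List ℕ)}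
    (hρ : StrictMonoOn ρ U) {d d' : Fin 7 → Fin k} (hdU : ∀ j, vertexWord k d j ∈ U)
    (hdU' : ∀ j, vertexWord k d' j ∈ U) (hne : d ≠ d') {P : Finset (Finset ℕ)}
    (hP : IsPattern 3 P)
    (hF : FormsPattern (univ.image fun j => ρ (vertexWord k d j))
      (univ.image fun j => ρ (vertexWord k d' j)) P) :
    ∃ i, d i ≠ d' i ∧ P = firstDiffPattern i := by
  obtain ⟨i, hlt, hi⟩ := exists_first_diff hne
  refine ⟨i, hi, ?_⟩
  rcases lt_or_gt_of_ne hi with h | h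
  · exact eq_firstDiffPattern hρ hdU hdU' hlt h hP hF
  · exact eq_firstDiffPattern hρ hdU' hdU (fun j hj => (hlt j hj).symm) h hP hF.symm

/-- The rank function of a finite subset of a linear order. -/
lemma exists_rank {α : Type*} [LinearOrder α] (U : Finset α) :
    ∃ ρ : α → ℕ, StrictMonoOn ρ U ∧ U.image ρ = Icc 1 U.card := by
  have hmono : StrictMonoOn (fun w => (U.filter (· ≤ w)).card) (U : Set α) := by
    intro u _ v hv huv
    refine card_lt_card (ssubset_iff_of_subset ?_ |>.2 ⟨v, ?_, ?_⟩)
    · exact fun w hw => mem_filter.2 ⟨(mem_filter.1 hw).1, (mem_filter.1 hw).2.trans huv.le⟩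
    · exact mem_filter.2 ⟨hv, le_rfl⟩
    · exact fun h => absurd (mem_filter.1 h).2 (not_le.2 huv)
  refine ⟨_, hmono, eq_of_subset_of_card_le ?_ ?_⟩
  · intro v hv
    obtain ⟨w, hw, rfl⟩ := mem_image.1 hv
    exact mem_Icc.2 ⟨card_pos.2 ⟨w, mem_filter.2 ⟨hw, le_rfl⟩⟩, card_le_card (filter_subset _ _)⟩
  · rw [card_image_of_injOn hmono.injOn]
    simp

lemma exists_isOrderedMatching_Lmax_le {n k : ℕ} (hk : 1 ≤ k) (hnk : n ≤ k ^ 7) :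
    ∃ M, IsOrderedMatching 3 n M ∧ Lmax 3 M ≤ k := by
  obtain ⟨T, -, hT⟩ := exists_subset_card_eq (s := (univ : Finset (Fin 7 → Fin k))) (n := n)
    (by simpa using hnk)
  set U : Finset (List ℕ) := (T ×ˢ (univ : Finset (Fin 3))).image
    fun p => vertexWord k p.1 p.2 with hU
  have hUcard : U.card = 3 * n := by
    rw [hU, card_image_of_injective _ (vertexWord_injective k), card_product, hT, card_univ,
      Fintype.card_fin, mul_comm]
  obtain ⟨ρ, hρ, hρU⟩ := exists_rank U
  have hmem : ∀ d ∈ T, ∀ j, vertexWord k d j ∈ U := fun d hd j =>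
    mem_image.2 ⟨(d, j), by simpa using hd, rfl⟩
  have hinj : ∀ d ∈ T, ∀ d' ∈ T, ∀ j j', ρ (vertexWord k d j) = ρ (vertexWord k d' j') →
      d = d' ∧ j = j' := by
    intro d hd d' hd' j j' h
    have := @vertexWord_injective k (d, j) (d', j') (hρ.injOn (hmem d hd j) (hmem d' hd' j') h)
    exact Prod.mk.inj this
  set E : (Fin 7 → Fin k) → Finset ℕ := fun d => univ.image fun j => ρ (vertexWord k d j) with hE
  have hdisj : ∀ d ∈ T, ∀ d' ∈ T, d ≠ d' → Disjoint (E d) (E d') := by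
    intro d hd d' hd' hne
    refine disjoint_left.2 fun v hv hv' => ?_
    obtain ⟨j, -, rfl⟩ := mem_image.1 hv
    obtain ⟨j', -, h⟩ := mem_image.1 hv'
    exact hne (hinj d' hd' d hd _ _ h).1.symm
  have hEinj : Set.InjOn E T := by
    intro d hd d' hd' h
    by_contra hne
    have h0 : ρ (vertexWord k d 0) ∈ E d := mem_image_of_mem _ (mem_univ 0)
    exact disjoint_left.1 (hdisj d hd d' hd' hne) h0 (h ▸ h0)
  refine ⟨T.image E, ⟨?_, ?_, ?_, ?_⟩, Lmax_le fun P hP S hS hc => ?_⟩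
  · rw [card_image_of_injOn hEinj, hT]
  · intro e he
    obtain ⟨d, hd, rfl⟩ := mem_image.1 he
    rw [hE, card_image_of_injective _ fun j j' h => (hinj d hd d hd j j' h).2]
    simp
  · intro e he f hf hne
    obtain ⟨d, hd, rfl⟩ := mem_image.1 he
    obtain ⟨d', hd', rfl⟩ := mem_image.1 hf
    exact hdisj d hd d' hd' fun h => hne (h ▸ rfl)
  · rw [← hUcard, ← hρU]
    ext v
    simp [hE, hU]
  · obtain ⟨T', hT', rfl⟩ := subset_image_iff.1 hS
    have hmem' : ∀ d ∈ T', ∀ j, vertexWord k d j ∈ (U : Set (List ℕ)) := fun d hd j =>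
      hmem d (hT' hd) j
    have key : ∀ d ∈ T', ∀ d' ∈ T', d ≠ d' → ∃ i, d i ≠ d' i ∧ P = firstDiffPattern i :=
      fun d hd d' hd' hne =>
        (hc (E d) (mem_image_of_mem E hd) (E d') (mem_image_of_mem E hd')
          fun h => hne (hEinj (hT' hd) (hT' hd') h)).exists_ne_and_eq_firstDiffPattern hρ
          (hmem' d hd) (hmem' d' hd') hne hP
    refine card_image_le.trans ?_
    by_cases h1 : T'.card ≤ 1
    · exact h1.trans hk
    obtain ⟨d, hd, d', hd', hne⟩ := one_lt_card.1 (not_le.1 h1)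
    obtain ⟨i, -, hi⟩ := key d hd d' hd' hne
    have hcard := card_le_card_of_injOn (s := T') (t := (univ : Finset (Fin k)))
      (fun d => d i) (fun _ _ => mem_univ _) (by
        intro a ha b hb hab
        by_contra hne
        obtain ⟨j, hj, hPj⟩ := key a ha b hb hne
        exact hj (firstDiffPattern_injective (hi.symm.trans hPj) ▸ hab))
    simpa using hcard

/-- **Theorem 1.2, case r = 3.** For every positive integer `n`, the Ramsey
parameter `L_3(n)` (the minimum of `L(M)` over ordered `3`-matchings `M` of
size `n`) satisfies `(1/2)·n^(1/7) ≤ L_3(n) ≤ ⌈n^(1/7)⌉`: every ordered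
`3`-matching of size `n` has `L(M) ≥ (1/2)·n^(1/7)`, and some ordered
`3`-matching of size `n` has `L(M) ≤ ⌈n^(1/7)⌉`. -/
theorem ramsey_three (n : ℕ) (hn : 1 ≤ n) :
    (∀ M : Finset (Finset ℕ), IsOrderedMatching 3 n M →
      (1 / 2 : ℝ) * (n : ℝ) ^ ((1 : ℝ) / 7) ≤ (Lmax 3 M : ℝ)) ∧
    (∃ M : Finset (Finset ℕ), IsOrderedMatching 3 n M ∧
      Lmax 3 M ≤ ⌈(n : ℝ) ^ ((1 : ℝ) / 7)⌉₊) := by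
  refine ⟨fun M hM => ?_, ?_⟩
  · obtain ⟨x, y, z, h⟩ := hM.exists_isCoords
    have hle : n ≤ 2 * Lmax 3 M ^ 7 := hM.1 ▸ h.card_le
    have hle' : (n : ℝ) ≤ (2 * (Lmax 3 M : ℝ)) ^ 7 :=
      calc (n : ℝ) ≤ 2 * (Lmax 3 M : ℝ) ^ 7 := by exact_mod_cast hle
        _ ≤ 2 ^ 7 * (Lmax 3 M : ℝ) ^ 7 := by gcongr; norm_num
        _ = (2 * (Lmax 3 M : ℝ)) ^ 7 := by ring
    have hroot : (n : ℝ) ^ ((1 : ℝ) / 7) ≤ 2 * (Lmax 3 M : ℝ) := by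
      rw [one_div]
      exact (Real.rpow_inv_le_iff_of_pos (by positivity) (by positivity) (by norm_num)).2
        (by exact_mod_cast hle')
    linarith
  · refine exists_isOrderedMatching_Lmax_le (Nat.one_le_ceil_iff.2 (by positivity)) ?_
    have hroot := Nat.le_ceil ((n : ℝ) ^ ((1 : ℝ) / 7))
    generalize ⌈(n : ℝ) ^ ((1 : ℝ) / 7)⌉₊ = k at hroot ⊢
    rw [one_div, Real.rpow_inv_le_iff_of_pos (by positivity) (by positivity) (by norm_num)] at hroot
    exact_mod_cast hroot
end

section
/- Fix an integer r ≥ 2 and an r-pattern P that is not r-partite. Then there exists a constant C = C(r) > 0 such that for all positive integers n: e^{−Cn}·n^{(r−1)n} ≤ N_P(n) ≤ e^{Cn}·n^{(r−1)n}. -/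
/-- An ordered `r`-matching on `{1,…,r*n}` is `r`-partite if, dividing the
vertex set into `r` contiguous intervals of length `n`, every edge has exactly
one vertex in each interval. -/
def IsPartite (r n : ℕ) (M : Finset (Finset ℕ)) : Prop :=
  ∀ e ∈ M, ∀ i : ℕ, 1 ≤ i → i ≤ r →
    (e ∩ Finset.Icc ((i - 1) * n + 1) (i * n)).card = 1

/-- `N_P(n)`: the number of ordered `r`-matchings on `{1,…,r*n}` in which no
two edges form the pattern `P`. -/
noncomputable def patternFreeCount (r n : ℕ) (P : Finset (Finset ℕ)) : ℕ :=
  Nat.card {M : Finset (Finset ℕ) // IsOrderedMatching r n M ∧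
    ∀ e ∈ M, ∀ f ∈ M, e ≠ f → ¬ FormsPattern e f P}

/-- A set with `c` elements in each of the `r` blocks of length `n` has `c * k` elements in the
first `k` blocks. -/
theorem card_inter_Icc_of_card_block {r n c : ℕ} {S : Finset ℕ}
    (hS : ∀ i : ℕ, 1 ≤ i → i ≤ r → (S ∩ Finset.Icc ((i - 1) * n + 1) (i * n)).card = c) :
    ∀ k ≤ r, (S ∩ Finset.Icc 1 (k * n)).card = c * k := by
  intro k
  induction k with
  | zero => simp
  | succ k ih =>
    intro hk
    have hsplit : S ∩ Finset.Icc 1 ((k + 1) * n) =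
        (S ∩ Finset.Icc 1 (k * n)) ∪ (S ∩ Finset.Icc (k * n + 1) ((k + 1) * n)) := by
      ext x
      simp only [Finset.mem_inter, Finset.mem_union, Finset.mem_Icc, add_mul, one_mul]
      grind
    have hdisj : Disjoint (S ∩ Finset.Icc 1 (k * n))
        (S ∩ Finset.Icc (k * n + 1) ((k + 1) * n)) := by
      rw [Finset.disjoint_left]
      intro x hx hx'
      simp only [Finset.mem_inter, Finset.mem_Icc] at hx hx'
      omega
    have hb := hS (k + 1) (by omega) hk
    rw [Nat.add_sub_cancel] at hb
    rw [hsplit, Finset.card_union_of_disjoint hdisj, ih (by omega), hb]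
    ring

/-- Every positive integer up to `r * n` lies in one of the `r` blocks of length `n`. -/
theorem exists_mem_block {r n x : ℕ} (hx : x ∈ Finset.Icc 1 (r * n)) :
    ∃ j, 1 ≤ j ∧ j ≤ r ∧ x ∈ Finset.Icc ((j - 1) * n + 1) (j * n) := by
  rw [Finset.mem_Icc] at hx
  have hn : 0 < n := by
    rcases Nat.eq_zero_or_pos n with rfl | h
    · omega
    · exact h
  have hlt : (x - 1) / n < r := by
    rw [Nat.div_lt_iff_lt_mul hn]
    omega
  refine ⟨(x - 1) / n + 1, Nat.le_add_left 1 _, hlt, ?_⟩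
  have h1 := Nat.div_mul_le_self (x - 1) n
  have h2 := Nat.lt_div_mul_add (a := x - 1) hn
  rw [Finset.mem_Icc, Nat.add_sub_cancel, add_mul, one_mul]
  omega

/-- Two disjoint edges with one vertex in each block can only form an `r`-partite pattern. -/
theorem isPartite_of_formsPattern {r n : ℕ} {e f : Finset ℕ} {P : Finset (Finset ℕ)}
    (hP : IsPattern r P) (he : e ⊆ Finset.Icc 1 (r * n)) (hf : f ⊆ Finset.Icc 1 (r * n))
    (hef : Disjoint e f) (hpart : IsPartite r n {e, f}) (h : FormsPattern e f P) :
    IsPartite r 2 P := by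
  obtain ⟨φ, hφ, rfl⟩ := h
  have hinj : Set.InjOn φ (↑(e ∪ f) : Set ℕ) := hφ.injOn
  have himg : (e ∪ f).image φ = Finset.Icc 1 (r * 2) := by
    rw [← hP.2.2.2, Finset.image_union]
    simp
  have hS : ∀ i : ℕ, 1 ≤ i → i ≤ r →
      ((e ∪ f) ∩ Finset.Icc ((i - 1) * n + 1) (i * n)).card = 2 := by
    intro i h1 hr
    rw [Finset.union_inter_distrib_right, Finset.card_union_of_disjoint
      (hef.mono Finset.inter_subset_left Finset.inter_subset_left),
      hpart e (by simp) i h1 hr, hpart f (by simp) i h1 hr]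
  have hsub : e ∪ f ⊆ Finset.Icc 1 (r * n) := Finset.union_subset he hf
  have hval : ∀ x ∈ e ∪ f, φ x = ((e ∪ f).filter (· ≤ x)).card := by
    intro x hx
    have hxr : φ x ∈ Finset.Icc 1 (r * 2) := himg ▸ Finset.mem_image_of_mem φ hx
    have : ((e ∪ f).filter (· ≤ x)).image φ = Finset.Icc 1 (φ x) := by
      ext y
      simp only [Finset.mem_image, Finset.mem_filter, Finset.mem_Icc] at hxr ⊢
      constructor
      · rintro ⟨z, ⟨hz, hzx⟩, rfl⟩
        have hzr : φ z ∈ Finset.Icc 1 (r * 2) := himg ▸ Finset.mem_image_of_mem φ hz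
        exact ⟨(Finset.mem_Icc.1 hzr).1, (hφ.le_iff_le hz hx).2 hzx⟩
      · rintro ⟨h1, h2⟩
        have hy : y ∈ (e ∪ f).image φ := by
          rw [himg, Finset.mem_Icc]
          omega
        obtain ⟨z, hz, rfl⟩ := Finset.mem_image.1 hy
        exact ⟨z, ⟨hz, (hφ.le_iff_le hz hx).1 h2⟩, rfl⟩
    rw [← Finset.card_image_of_injOn
      (hinj.mono (Finset.coe_subset.2 (Finset.filter_subset (· ≤ x) (e ∪ f)))), this]
    simp
  have hblock : ∀ j, 1 ≤ j → j ≤ r → ∀ x ∈ e ∪ f,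
      x ∈ Finset.Icc ((j - 1) * n + 1) (j * n) → (j - 1) * 2 + 1 ≤ φ x ∧ φ x ≤ j * 2 := by
    intro j h1 hr x hx hxj
    rw [Finset.mem_Icc] at hxj
    rw [hval x hx]
    constructor
    · rw [mul_comm (j - 1) 2, ← card_inter_Icc_of_card_block hS (j - 1) (by omega),
        Nat.succ_le_iff]
      refine Finset.card_lt_card (Finset.ssubset_iff_of_subset ?_ |>.2 ⟨x, ?_, ?_⟩)
      · intro y hy
        simp only [Finset.mem_inter, Finset.mem_Icc, Finset.mem_filter] at hy ⊢
        exact ⟨hy.1, by omega⟩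
      · simp [Finset.mem_union.1 hx]
      · simp only [Finset.mem_inter, Finset.mem_Icc]
        omega
    · rw [mul_comm j 2, ← card_inter_Icc_of_card_block hS j hr]
      refine Finset.card_le_card fun y hy => ?_
      rw [Finset.mem_filter] at hy
      have := Finset.mem_Icc.1 (hsub hy.1)
      simp only [Finset.mem_inter, Finset.mem_Icc]
      exact ⟨hy.1, by omega⟩
  have key : ∀ g ∈ ({e, f} : Finset (Finset ℕ)), ∀ i : ℕ, 1 ≤ i → i ≤ r →
      (g.image φ ∩ Finset.Icc ((i - 1) * 2 + 1) (i * 2)).card = 1 := by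
    intro g hg i h1 hr
    have hgS : g ⊆ e ∪ f := by
      rcases Finset.mem_insert.1 hg with rfl | hg
      · exact Finset.subset_union_left
      · rw [Finset.mem_singleton.1 hg]
        exact Finset.subset_union_right
    have : g.image φ ∩ Finset.Icc ((i - 1) * 2 + 1) (i * 2) =
        (g ∩ Finset.Icc ((i - 1) * n + 1) (i * n)).image φ := by
      ext y
      simp only [Finset.mem_inter, Finset.mem_image]
      constructor
      · rintro ⟨⟨x, hx, rfl⟩, hy⟩
        rw [Finset.mem_Icc] at hy
        obtain ⟨j, hj1, hjr, hxj⟩ := exists_mem_block (hsub (hgS hx))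
        have := hblock j hj1 hjr x (hgS hx) hxj
        obtain rfl : j = i := by omega
        exact ⟨x, ⟨hx, hxj⟩, rfl⟩
      · rintro ⟨x, ⟨hx, hxi⟩, rfl⟩
        exact ⟨⟨x, hx, rfl⟩, Finset.mem_Icc.2 (hblock i h1 hr x (hgS hx) hxi)⟩
    rw [this, Finset.card_image_of_injOn
      (hinj.mono (Finset.coe_subset.2 (Finset.inter_subset_left.trans hgS))), hpart g hg i h1 hr]
  intro g hg
  rcases Finset.mem_insert.1 hg with rfl | hg
  · exact key e (by simp)
  · rw [Finset.mem_singleton.1 hg]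
    exact key f (by simp)

/-- There are finitely many ordered matchings of given parameters. -/
theorem finite_isOrderedMatching (r n : ℕ) : {M | IsOrderedMatching r n M}.Finite := by
  refine ((Finset.Icc 1 (r * n)).powerset.powerset.finite_toSet).subset fun M hM => ?_
  simp only [Finset.coe_powerset, Set.mem_preimage, Set.mem_powerset_iff]
  intro e he
  simp only [Set.mem_preimage, Set.mem_powerset_iff, Finset.coe_subset]
  rw [← hM.2.2.2]
  exact Finset.subset_biUnion_of_mem id he

/-- Labelling the edges of an ordered matching turns it into a function from vertices to
labels. -/
theorem card_isOrderedMatching_mul_factorial_le (r n : ℕ) :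
    Nat.card {M // IsOrderedMatching r n M} * n.factorial ≤ n ^ (r * n) := by
  have : Finite {M // IsOrderedMatching r n M} := finite_isOrderedMatching r n
  have ε (M : {M // IsOrderedMatching r n M}) : Fin n ≃ M.1 :=
    (finCongr M.2.1.symm).trans M.1.equivFin.symm
  have hex (p : {M // IsOrderedMatching r n M} × Equiv.Perm (Fin n))
      (v : Finset.Icc 1 (r * n)) : ∃ k, v.1 ∈ (ε p.1 (p.2 k)).1 := by
    obtain ⟨e, he, hve⟩ := Finset.mem_biUnion.1 (p.1.2.2.2.2.ge v.2)
    exact ⟨p.2.symm ((ε p.1).symm ⟨e, he⟩), by simpa using hve⟩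
  choose F hF using hex
  have hedge (p) (k : Fin n) (v : Finset.Icc 1 (r * n)) :
      v.1 ∈ (ε p.1 (p.2 k)).1 ↔ F p v = k := by
    refine ⟨fun hv => ?_, fun h => h ▸ hF p v⟩
    by_contra hne
    have hne' : (ε p.1 (p.2 (F p v))).1 ≠ (ε p.1 (p.2 k)).1 := fun h =>
      hne (p.2.injective ((ε p.1).injective (Subtype.ext h)))
    exact Finset.disjoint_left.1
      (p.1.2.2.2.1 _ (ε p.1 _).2 _ (ε p.1 _).2 hne') (hF p v) hv
  have hinj : Function.Injective F := by
    rintro p q hpq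
    have hE : ∀ k, (ε p.1 (p.2 k)).1 = (ε q.1 (q.2 k)).1 := by
      have hsub : ∀ (p : {M // IsOrderedMatching r n M} × Equiv.Perm (Fin n)) (k : Fin n),
          (ε p.1 (p.2 k)).1 ⊆ Finset.Icc 1 (r * n) := fun p k => by
        rw [← p.1.2.2.2.2]
        exact Finset.subset_biUnion_of_mem id (ε p.1 (p.2 k)).2
      intro k
      ext v
      constructor
      · intro hv
        have := (hedge p k ⟨v, hsub p k hv⟩).1 hv
        rw [hpq] at this
        exact (hedge q k ⟨v, hsub p k hv⟩).2 this
      · intro hv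
        have := (hedge q k ⟨v, hsub q k hv⟩).1 hv
        rw [← hpq] at this
        exact (hedge p k ⟨v, hsub q k hv⟩).2 this
    obtain ⟨M, σ⟩ := p
    obtain ⟨N, τ⟩ := q
    have hMN : M = N := by
      refine Subtype.ext (Finset.ext fun e => ⟨fun he => ?_, fun he => ?_⟩)
      · have := hE (σ.symm ((ε M).symm ⟨e, he⟩))
        simp only [Equiv.apply_symm_apply] at this
        exact this ▸ (ε N _).2
      · have := hE (τ.symm ((ε N).symm ⟨e, he⟩))
        simp only [Equiv.apply_symm_apply] at this
        exact this ▸ (ε M _).2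
    subst hMN
    exact Prod.ext rfl (Equiv.ext fun k => (ε M).injective (Subtype.ext (hE k)))
  have := Nat.card_le_card_of_injective F hinj
  rwa [Nat.card_prod, Nat.card_perm, Nat.card_fun, Nat.card_fin,
    Nat.card_eq_fintype_card (α := Finset.Icc 1 (r * n)), Fintype.card_coe, Nat.card_Icc,
    Nat.add_sub_cancel] at this

/-- The edge with label `k` of the partite matching given by one permutation per block. -/
def partiteEdge {r n : ℕ} (τ : Fin r → Equiv.Perm (Fin n)) (k : Fin n) : Finset ℕ :=
  Finset.univ.image fun i : Fin r => (i : ℕ) * n + τ i k + 1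

theorem mem_partiteEdge {r n : ℕ} {τ : Fin r → Equiv.Perm (Fin n)} {k : Fin n} {i : Fin r}
    {a : Fin n} : (i : ℕ) * n + a + 1 ∈ partiteEdge τ k ↔ τ i k = a := by
  simp only [partiteEdge, Finset.mem_image, Finset.mem_univ, true_and]
  constructor
  · rintro ⟨j, hj⟩
    have h : (j : ℕ) * n + τ j k = i * n + a := by omega
    have hn : 0 < n := k.pos
    have hji : (j : ℕ) = i := by
      have := congrArg (· / n) h
      simpa [mul_comm _ n, Nat.mul_add_div hn, Nat.div_eq_of_lt] using this
    obtain rfl := Fin.ext hji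
    exact Fin.ext (by omega)
  · rintro rfl
    exact ⟨i, rfl⟩

/-- Every vertex has a block and a position in the block. -/
theorem exists_eq_of_mem_Icc {r n x : ℕ} (hx : x ∈ Finset.Icc 1 (r * n)) :
    ∃ (i : Fin r) (a : Fin n), x = (i : ℕ) * n + a + 1 := by
  obtain ⟨j, h1, hr, hj⟩ := exists_mem_block hx
  rw [Finset.mem_Icc] at hj
  have hjn : j * n = (j - 1) * n + n := by
    rw [← Nat.succ_mul, Nat.succ_eq_add_one, Nat.sub_add_cancel h1]
  exact ⟨⟨j - 1, by omega⟩, ⟨x - 1 - (j - 1) * n, by omega⟩, by simp only; omega⟩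

theorem partiteEdge_subset {r n : ℕ} (τ : Fin r → Equiv.Perm (Fin n)) (k : Fin n) :
    partiteEdge τ k ⊆ Finset.Icc 1 (r * n) := by
  intro x hx
  simp only [partiteEdge, Finset.mem_image, Finset.mem_univ, true_and] at hx
  obtain ⟨i, rfl⟩ := hx
  have h1 : ((i : ℕ) + 1) * n ≤ r * n := Nat.mul_le_mul_right n i.2
  have h2 := (τ i k).2
  rw [Finset.mem_Icc]
  rw [add_mul, one_mul] at h1
  omega

theorem card_partiteEdge {r n : ℕ} (τ : Fin r → Equiv.Perm (Fin n)) (k : Fin n) :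
    (partiteEdge τ k).card = r := by
  rw [partiteEdge, Finset.card_image_of_injective, Finset.card_univ, Fintype.card_fin]
  intro i j hij
  have h : (i : ℕ) * n + τ i k = j * n + τ j k := by simpa using hij
  have := congrArg (· / n) h
  exact Fin.ext (by simpa [mul_comm _ n, Nat.mul_add_div k.pos, Nat.div_eq_of_lt] using this)

theorem disjoint_partiteEdge {r n : ℕ} (τ : Fin r → Equiv.Perm (Fin n)) {k l : Fin n}
    (hkl : k ≠ l) : Disjoint (partiteEdge τ k) (partiteEdge τ l) := by
  rw [Finset.disjoint_left]
  intro x hx hx'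
  obtain ⟨i, a, rfl⟩ := exists_eq_of_mem_Icc (partiteEdge_subset τ k hx)
  rw [mem_partiteEdge] at hx hx'
  exact hkl ((τ i).injective (hx.trans hx'.symm))

theorem card_partiteEdge_inter_block {r n : ℕ} (τ : Fin r → Equiv.Perm (Fin n)) (k : Fin n)
    {i : ℕ} (h1 : 1 ≤ i) (hr : i ≤ r) :
    (partiteEdge τ k ∩ Finset.Icc ((i - 1) * n + 1) (i * n)).card = 1 := by
  obtain ⟨i, rfl⟩ := Nat.exists_eq_add_of_le' h1
  rw [Finset.card_eq_one]
  refine ⟨i * n + τ ⟨i, hr⟩ k + 1, ?_⟩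
  ext x
  rw [Finset.mem_inter, Finset.mem_singleton, Nat.add_sub_cancel, Finset.mem_Icc, add_mul, one_mul]
  constructor
  · rintro ⟨hx, hlo, hhi⟩
    have hxe : x = ((⟨i, hr⟩ : Fin r) : ℕ) * n + (⟨x - 1 - i * n, by omega⟩ : Fin n) + 1 := by
      simp only
      omega
    rw [hxe, mem_partiteEdge] at hx
    rw [hx]
    exact hxe
  · rintro rfl
    have := (τ ⟨i, hr⟩ k).2
    exact ⟨mem_partiteEdge (i := ⟨i, hr⟩).2 rfl, by omega, by omega⟩

/-- The partite matching given by one permutation per block. -/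
def partiteMatching {r n : ℕ} (τ : Fin r → Equiv.Perm (Fin n)) : Finset (Finset ℕ) :=
  Finset.univ.image (partiteEdge τ)

theorem mem_partiteMatching {r n : ℕ} {τ : Fin r → Equiv.Perm (Fin n)} {e : Finset ℕ} :
    e ∈ partiteMatching τ ↔ ∃ k, partiteEdge τ k = e := by
  simp [partiteMatching]

theorem isOrderedMatching_partiteMatching {r n : ℕ} (hr : 0 < r)
    (τ : Fin r → Equiv.Perm (Fin n)) : IsOrderedMatching r n (partiteMatching τ) := by
  refine ⟨?_, ?_, ?_, ?_⟩
  · rw [partiteMatching, Finset.card_image_of_injective, Finset.card_univ, Fintype.card_fin]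
    intro k l hkl
    by_contra hne
    have hd := disjoint_partiteEdge τ hne
    rw [← hkl, disjoint_self, Finset.bot_eq_empty] at hd
    have := card_partiteEdge τ k
    rw [hd, Finset.card_empty] at this
    omega
  · intro e he
    obtain ⟨k, rfl⟩ := mem_partiteMatching.1 he
    exact card_partiteEdge τ k
  · intro e he f hf hef
    obtain ⟨k, rfl⟩ := mem_partiteMatching.1 he
    obtain ⟨l, rfl⟩ := mem_partiteMatching.1 hf
    exact disjoint_partiteEdge τ fun h => hef (h ▸ rfl)
  · ext x
    rw [Finset.mem_biUnion]
    constructor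
    · rintro ⟨e, he, hx⟩
      obtain ⟨k, rfl⟩ := mem_partiteMatching.1 he
      exact partiteEdge_subset τ k hx
    · intro hx
      obtain ⟨i, a, rfl⟩ := exists_eq_of_mem_Icc hx
      exact ⟨_, mem_partiteMatching.2 ⟨(τ i).symm a, rfl⟩, mem_partiteEdge.2 (by simp)⟩

/-- Partite matchings avoid every pattern that is not partite. -/
theorem not_formsPattern_of_mem_partiteMatching {r n : ℕ} {P : Finset (Finset ℕ)}
    (hP : IsPattern r P) (hnp : ¬ IsPartite r 2 P) (τ : Fin r → Equiv.Perm (Fin n)) :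
    ∀ e ∈ partiteMatching τ, ∀ f ∈ partiteMatching τ, e ≠ f → ¬ FormsPattern e f P := by
  intro e he f hf hef h
  obtain ⟨k, rfl⟩ := mem_partiteMatching.1 he
  obtain ⟨l, rfl⟩ := mem_partiteMatching.1 hf
  refine hnp (isPartite_of_formsPattern hP (partiteEdge_subset τ k) (partiteEdge_subset τ l)
    (disjoint_partiteEdge τ fun h => hef (h ▸ rfl)) ?_ h)
  intro g hg i h1 hr
  rcases Finset.mem_insert.1 hg with rfl | hg
  · exact card_partiteEdge_inter_block τ k h1 hr
  · rw [Finset.mem_singleton.1 hg]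
    exact card_partiteEdge_inter_block τ l h1 hr

/-- A partite matching determines the permutations if the first one is the identity. -/
theorem partiteMatching_cons_one_injective (s n : ℕ) :
    Function.Injective fun σ : Fin s → Equiv.Perm (Fin n) =>
      partiteMatching (Fin.cons 1 σ : Fin (s + 1) → Equiv.Perm (Fin n)) := by
  intro σ σ' h
  funext i
  ext1 k
  set τ : Fin (s + 1) → Equiv.Perm (Fin n) := Fin.cons 1 σ with hτ
  set τ' : Fin (s + 1) → Equiv.Perm (Fin n) := Fin.cons 1 σ' with hτ'
  have hk : partiteEdge τ k ∈ partiteMatching τ' := by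
    rw [← show partiteMatching τ = partiteMatching τ' from h]
    exact mem_partiteMatching.2 ⟨k, rfl⟩
  obtain ⟨l, hl⟩ := mem_partiteMatching.1 hk
  have hτl (j : Fin (s + 1)) : τ' j l = τ j k := by
    rw [← mem_partiteEdge, hl, mem_partiteEdge]
  obtain rfl : l = k := by simpa [hτ, hτ'] using hτl 0
  simpa [hτ, hτ'] using (hτl i.succ).symm

theorem factorial_pow_le_patternFreeCount {s n : ℕ} {P : Finset (Finset ℕ)}
    (hP : IsPattern (s + 1) P) (hnp : ¬ IsPartite (s + 1) 2 P) :
    n.factorial ^ s ≤ patternFreeCount (s + 1) n P := by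
  have : Finite {M : Finset (Finset ℕ) // IsOrderedMatching (s + 1) n M ∧
      ∀ e ∈ M, ∀ f ∈ M, e ≠ f → ¬ FormsPattern e f P} :=
    (finite_isOrderedMatching (s + 1) n).subset fun _ hM => hM.1
  have := Nat.card_le_card_of_injective
    (fun σ : Fin s → Equiv.Perm (Fin n) =>
      (⟨partiteMatching (Fin.cons 1 σ : Fin (s + 1) → Equiv.Perm (Fin n)),
        isOrderedMatching_partiteMatching s.succ_pos _,
        not_formsPattern_of_mem_partiteMatching hP hnp _⟩ :
        {M : Finset (Finset ℕ) // IsOrderedMatching (s + 1) n M ∧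
          ∀ e ∈ M, ∀ f ∈ M, e ≠ f → ¬ FormsPattern e f P})) fun σ σ' h =>
      partiteMatching_cons_one_injective s n (congrArg Subtype.val h)
  simpa [patternFreeCount, Fintype.card_perm] using this

theorem patternFreeCount_mul_factorial_le (r n : ℕ) (P : Finset (Finset ℕ)) :
    patternFreeCount r n P * n.factorial ≤ n ^ (r * n) := by
  have : Finite {M // IsOrderedMatching r n M} := finite_isOrderedMatching r n
  refine le_trans (Nat.mul_le_mul_right _ ?_) (card_isOrderedMatching_mul_factorial_le r n)
  exact Nat.card_le_card_of_injective (Subtype.map id fun _ hM => hM.1)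
    (Subtype.map_injective _ Function.injective_id)

theorem pow_self_le_exp_mul_factorial (n : ℕ) :
    (n : ℝ) ^ n ≤ Real.exp n * n.factorial := by
  have := Real.pow_div_factorial_le_exp (n : ℝ) n.cast_nonneg n
  rwa [div_le_iff₀ (by positivity)] at this

/-- **Proposition 1.5.** For a fixed `r ≥ 2` and an `r`-pattern `P` which is
not `r`-partite, `N_P(n) = e^{O_r(n)} · n^{(r-1)n}`. -/
theorem count_nonpartite_pattern_free (r : ℕ) (hr : 2 ≤ r)
    (P : Finset (Finset ℕ)) (hP : IsPattern r P) (hnp : ¬ IsPartite r 2 P) :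
    ∃ C : ℝ, 0 < C ∧ ∀ n : ℕ, 1 ≤ n →
      Real.exp (-(C * n)) * (n : ℝ) ^ ((r - 1) * n) ≤ (patternFreeCount r n P : ℝ) ∧
      (patternFreeCount r n P : ℝ) ≤ Real.exp (C * n) * (n : ℝ) ^ ((r - 1) * n) := by
  obtain ⟨s, rfl⟩ := Nat.exists_eq_add_of_le' (show 1 ≤ r by omega)
  refine ⟨s, by exact_mod_cast (by omega : 0 < s), fun n hn => ?_⟩
  have hs : (1 : ℝ) ≤ s := by exact_mod_cast (by omega : 1 ≤ s)
  have hn' : (0 : ℝ) < n := by exact_mod_cast hn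
  have hfact := pow_self_le_exp_mul_factorial n
  rw [Nat.add_sub_cancel]
  constructor
  · have hlow : ((n.factorial : ℝ)) ^ s ≤ patternFreeCount (s + 1) n P := by
      exact_mod_cast factorial_pow_le_patternFreeCount hP hnp
    refine le_trans ?_ hlow
    have hpow := pow_le_pow_left₀ (by positivity) hfact s
    rw [mul_pow, ← Real.exp_nat_mul, ← pow_mul, mul_comm n s] at hpow
    rw [Real.exp_neg, inv_mul_le_iff₀ (Real.exp_pos _)]
    exact hpow
  · have hup : (patternFreeCount (s + 1) n P : ℝ) * n.factorial ≤ n ^ ((s + 1) * n) := by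
      exact_mod_cast patternFreeCount_mul_factorial_le (s + 1) n P
    have hexp : Real.exp n ≤ Real.exp (s * n) := Real.exp_le_exp.2 (by nlinarith)
    refine le_trans ?_ (mul_le_mul_of_nonneg_right hexp (by positivity))
    refine le_of_mul_le_mul_right ?_ (show (0 : ℝ) < n.factorial by positivity)
    calc (patternFreeCount (s + 1) n P : ℝ) * n.factorial ≤ n ^ ((s + 1) * n) := hup
      _ = (n : ℝ) ^ (s * n) * n ^ n := by rw [← pow_add]; ring_nf
      _ ≤ (n : ℝ) ^ (s * n) * (Real.exp n * n.factorial) := by gcongr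
      _ = Real.exp n * (n : ℝ) ^ (s * n) * n.factorial := by ring
end
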